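/- L² bound for a cubic product in ℝ^{3+1}. Let s ∈ (5/6, 1) and let ε > 0 be sufficiently small. There is a constant C = C(s, ε, m₁) such that for every N ≥ 1, every δ ∈ (0,1], and all Schwartz functions φ₁, φ₂, φ₃ on ℝ³ × ℝ, ‖I_N(φ₁ φ₂ φ₃)‖_{L²([0,δ] × ℝ³)} ≤ C ‖∇ I_N φ₁‖_{X^δ_{0, 1/2+ε}} ‖∇ I_N φ₂‖_{X^δ_{0, 1/2+ε}} ‖∇ I_N φ₃‖_{X^δ_{0, 1/2+ε}}. -/

import Mathlib

open MeasureTheory Complex Set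
open scoped FourierTransform BigOperators RealInnerProductSpace

noncomputable section

abbrev Rn (n : ℕ) := EuclideanSpace ℝ (Fin n)

/-- Japanese bracket of a vector. -/
def jap {n : ℕ} (ξ : Rn n) : ℝ := Real.sqrt (1 + ‖ξ‖ ^ 2)

/-- Japanese bracket of a real number. -/
def japR (x : ℝ) : ℝ := Real.sqrt (1 + x ^ 2)

/-- Inhomogeneous Sobolev norm ‖⟨ξ⟩^s f̂‖_{L²}. -/
def sobNorm (n : ℕ) (s : ℝ) (f : Rn n → ℂ) : ℝ :=
  (∫ ξ : Rn n, jap ξ ^ (2 * s) * ‖𝓕 f ξ‖ ^ 2) ^ (1/2 : ℝ)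

/-- Homogeneous Sobolev norm ‖|ξ|^s f̂‖_{L²}. -/
def sobNormHom (n : ℕ) (s : ℝ) (f : Rn n → ℂ) : ℝ :=
  (∫ ξ : Rn n, ‖ξ‖ ^ (2 * s) * ‖𝓕 f ξ‖ ^ 2) ^ (1/2 : ℝ)

/-- L^p norm on ℝⁿ. -/
def lpNorm (n : ℕ) (p : ℝ) (f : Rn n → ℂ) : ℝ :=
  (∫ x : Rn n, ‖f x‖ ^ p) ^ (1/p)

/-- Laplacian: sum of second partial derivatives. -/
def laplacian {n : ℕ} (f : Rn n → ℂ) (x : Rn n) : ℂ :=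
  ∑ i : Fin n, fderiv ℝ (fun y => fderiv ℝ f y (EuclideanSpace.single i 1)) x
    (EuclideanSpace.single i 1)

/-- Complex gradient as a vector in Euclidean space. -/
def gradC {n : ℕ} (f : Rn n → ℂ) (x : Rn n) : EuclideanSpace ℂ (Fin n) :=
  (WithLp.equiv 2 (Fin n → ℂ)).symm fun i => fderiv ℝ f x (EuclideanSpace.single i 1)

/-- φ is a solution of the cubic defocussing NLS on ℝⁿ × [0,T] with data φ₀:
smooth, Schwartz in x uniformly for t ∈ [0,T] (with all derivatives),
satisfying i∂ₜφ + Δφ = |φ|²φ and φ(·,0) = φ₀. -/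
def IsNLSSolution (n : ℕ) (T : ℝ) (φ : Rn n → ℝ → ℂ) (φ₀ : Rn n → ℂ) : Prop :=
  ContDiff ℝ (⊤ : ℕ∞) (fun p : Rn n × ℝ => φ p.1 p.2) ∧
  (∀ k l : ℕ, ∃ C : ℝ, ∀ t ∈ Icc (0:ℝ) T, ∀ x : Rn n,
      ‖x‖ ^ k * ‖iteratedFDeriv ℝ l (fun y => φ y t) x‖ ≤ C) ∧
  (∀ x : Rn n, ∀ t ∈ Icc (0:ℝ) T,
      Complex.I * deriv (fun t' => φ x t') t + laplacian (fun y => φ y t) x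
        = (‖φ x t‖ : ℂ) ^ 2 * φ x t) ∧
  (∀ x : Rn n, φ x 0 = φ₀ x)

/-- The energy E(f) = ∫ (1/2)|∇f|² + (1/4)|f|⁴. -/
def energy {n : ℕ} (f : Rn n → ℂ) : ℝ :=
  ∫ x : Rn n, ((1/2 : ℝ) * ∑ i : Fin n, ‖fderiv ℝ f x (EuclideanSpace.single i 1)‖ ^ 2
    + (1/4 : ℝ) * ‖f x‖ ^ 4)

/-- m₁ is a smooth, radially symmetric, nonincreasing multiplier with
m₁ = 1 on the unit ball, m₁(ξ) = |ξ|^{-(1-s)} for |ξ| ≥ 2, 0 < m₁ ≤ 1. -/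
def IsAdmissibleMultiplier (n : ℕ) (s : ℝ) (m₁ : Rn n → ℝ) : Prop :=
  ContDiff ℝ (⊤ : ℕ∞) m₁ ∧
  (∀ ξ : Rn n, 0 < m₁ ξ ∧ m₁ ξ ≤ 1) ∧
  (∀ ξ η : Rn n, ‖ξ‖ = ‖η‖ → m₁ ξ = m₁ η) ∧
  (∀ ξ η : Rn n, ‖ξ‖ ≤ ‖η‖ → m₁ η ≤ m₁ ξ) ∧
  (∀ ξ : Rn n, ‖ξ‖ ≤ 1 → m₁ ξ = 1) ∧
  (∀ ξ : Rn n, 2 ≤ ‖ξ‖ → m₁ ξ = ‖ξ‖ ^ (-(1 - s)))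

/-- The rescaled multiplier m_N(ξ) = m₁(ξ/N). -/
def mN {n : ℕ} (m₁ : Rn n → ℝ) (N : ℝ) (ξ : Rn n) : ℝ := m₁ (N⁻¹ • ξ)

/-- The smoothing operator I_N with Fourier multiplier m_N. -/
def Iop {n : ℕ} (m₁ : Rn n → ℝ) (N : ℝ) (f : Rn n → ℂ) : Rn n → ℂ :=
  fun x => 𝓕⁻ (fun ξ => (mN m₁ N ξ : ℂ) * 𝓕 f ξ) x

/-- The spatial multiplier ⟨∇⟩^s. -/
def japMul (n : ℕ) (s : ℝ) (f : Rn n → ℂ) : Rn n → ℂ :=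
  fun x => 𝓕⁻ (fun ξ => ((jap ξ ^ s : ℝ) : ℂ) * 𝓕 f ξ) x

/-- Sharp Littlewood–Paley projection onto {M ≤ ⟨ξ⟩ ≤ 2M}. -/
def LP (n : ℕ) (M : ℝ) (f : Rn n → ℂ) : Rn n → ℂ :=
  fun x => 𝓕⁻ (fun ξ => if M ≤ jap ξ ∧ jap ξ ≤ 2 * M then 𝓕 f ξ else 0) x

/-- Space-time Fourier transform ψ̃(ξ,τ). -/
def stFourier (n : ℕ) {E : Type*} [NormedAddCommGroup E] [NormedSpace ℂ E]
    (ψ : Rn n → ℝ → E) (ξ : Rn n) (τ : ℝ) : E :=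
  ∫ x : Rn n, ∫ t : ℝ,
    Complex.exp (Complex.I * ((-2 * Real.pi * (⟪x, ξ⟫ + t * τ) : ℝ) : ℂ)) • ψ x t

/-- The X_{s,b} norm ‖⟨ξ⟩^s ⟨τ-|ξ|²⟩^b ψ̃‖_{L²}. -/
def XNorm (n : ℕ) {E : Type*} [NormedAddCommGroup E] [NormedSpace ℂ E]
    (s b : ℝ) (ψ : Rn n → ℝ → E) : ℝ :=
  (∫ ξ : Rn n, ∫ τ : ℝ,
    jap ξ ^ (2 * s) * japR (τ - ‖ξ‖ ^ 2) ^ (2 * b) * ‖stFourier n ψ ξ τ‖ ^ 2) ^ (1/2 : ℝ)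

/-- The restricted norm X^δ_{s,b}: infimum over Schwartz extensions off ℝⁿ × [0,δ]. -/
def XRNorm (n : ℕ) {E : Type*} [NormedAddCommGroup E] [NormedSpace ℂ E]
    (s b δ : ℝ) (f : Rn n → ℝ → E) : ℝ :=
  sInf { r : ℝ | ∃ ψ : SchwartzMap (Rn n × ℝ) E,
    (∀ x : Rn n, ∀ t ∈ Icc (0:ℝ) δ, ψ (x, t) = f x t) ∧
    r = XNorm n s b (fun x t => ψ (x, t)) }

/-- Space-time L^p norm on ℝⁿ × ℝ. -/
def lpNormST (n : ℕ) {E : Type*} [NormedAddCommGroup E] (p : ℝ) (F : Rn n → ℝ → E) : ℝ :=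
  (∫ t : ℝ, ∫ x : Rn n, ‖F x t‖ ^ p) ^ (1/p)

/-- Space-time L^p norm on ℝⁿ × [0,δ]. -/
def lpNormSTt (n : ℕ) {E : Type*} [NormedAddCommGroup E] (p δ : ℝ) (F : Rn n → ℝ → E) : ℝ :=
  (∫ t in Icc (0:ℝ) δ, ∫ x : Rn n, ‖F x t‖ ^ p) ^ (1/p)

section Plancherel
open scoped SchwartzMap

variable {V : Type*} [NormedAddCommGroup V] [InnerProductSpace ℝ V] [FiniteDimensional ℝ V]
  [MeasurableSpace V] [BorelSpace V]

/-- The integral Fourier transform of a function in `L¹ ∩ L²` represents its `L²` Fourier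
transform. -/
theorem fourier_toLp_ae_eq {G : V → ℂ} (hG : Integrable G) (hG2 : MemLp G 2) :
    (𝓕 (hG2.toLp G) : Lp ℂ 2 (volume : Measure V)) =ᵐ[volume] 𝓕 G := by
  have hcont : Continuous (𝓕 G) :=
    VectorFourier.fourierIntegral_continuous Real.continuous_fourierChar continuous_inner hG
  refine ae_eq_of_integral_contDiff_smul_eq
    ((Lp.memLp _).locallyIntegrable (by norm_num)) hcont.locallyIntegrable fun u hu hu' => ?_
  have hu1 : ContDiff ℝ (⊤ : ℕ∞) (fun x => (u x : ℂ)) := Complex.ofRealCLM.contDiff.comp hu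
  have hu2 : HasCompactSupport (fun x => (u x : ℂ)) :=
    hu'.comp_left (g := fun y : ℝ => (y : ℂ)) Complex.ofReal_zero
  let U : 𝓢(V, ℂ) := hu2.toSchwartzMap hu1
  have hU : ∀ x, U x = (u x : ℂ) := fun x => rfl
  have h1 := congrArg (fun T => T U)
    (MeasureTheory.Lp.fourier_toTemperedDistribution_eq (hG2.toLp G))
  simp only [TemperedDistribution.fourier_apply, Lp.toTemperedDistribution_apply, hU] at h1
  simp only [Complex.real_smul]
  simp only [smul_eq_mul] at h1
  rw [← h1]
  have h2 := VectorFourier.integral_fourierIntegral_smul_eq_flip (L := innerₗ V)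
      Real.continuous_fourierChar continuous_inner
    (U.integrable (μ := volume)) hG
  simp only [flip_innerₗ, smul_eq_mul] at h2
  calc ∫ x, (𝓕 U) x * (hG2.toLp G) x = ∫ x, (𝓕 U) x * G x := by
        refine integral_congr_ae ?_
        filter_upwards [hG2.coeFn_toLp] with x hx
        rw [hx]
    _ = ∫ x, U x * 𝓕 G x := h2
    _ = _ := rfl

theorem lintegral_enorm_fourier_sq_le {G : V → ℂ} (hG : Integrable G) :
    ∫⁻ x, ‖𝓕 G x‖ₑ ^ 2 ≤ ∫⁻ x, ‖G x‖ₑ ^ 2 := by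
  by_cases h : ∫⁻ x, ‖G x‖ₑ ^ 2 = ⊤
  · rw [h]; exact le_top
  have key : ∀ f : V → ℂ, eLpNorm f 2 volume ^ 2 = ∫⁻ x, ‖f x‖ₑ ^ 2 := fun f => by
    have := eLpNorm_nnreal_pow_eq_lintegral (f := f) (μ := (volume : Measure V)) (p := 2) (by norm_num)
    simpa using this
  have hG2 : MemLp G 2 := by
    refine ⟨hG.1, ?_⟩
    rw [← key] at h
    by_contra hc
    rw [not_lt, top_le_iff] at hc
    exact h (by rw [hc]; simp)
  rw [← key, ← key, ← eLpNorm_congr_ae (fourier_toLp_ae_eq hG hG2),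
    ← eLpNorm_congr_ae hG2.coeFn_toLp]
  have := Lp.norm_fourier_eq (hG2.toLp G)
  rw [Lp.norm_def, Lp.norm_def, ENNReal.toReal_eq_toReal_iff' (Lp.eLpNorm_ne_top _)
    (Lp.eLpNorm_ne_top _)] at this
  rw [this]

theorem lintegral_enorm_fourierInv_sq_le {G : V → ℂ} (hG : Integrable G) :
    ∫⁻ x, ‖𝓕⁻ G x‖ₑ ^ 2 ≤ ∫⁻ x, ‖G x‖ₑ ^ 2 := by
  simp_rw [Real.fourierInv_eq_fourier_neg]
  rw [lintegral_neg_eq_self (fun x => ‖𝓕 G x‖ₑ ^ 2)]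
  exact lintegral_enorm_fourier_sq_le hG

/-- Cauchy–Schwarz for integrals in `ℝ≥0∞`, with a weight. -/
theorem sq_lintegral_mul_le {α : Type*} [MeasurableSpace α] (μ : Measure α)
    {f g : α → ENNReal} (hf : AEMeasurable f μ) (hg : AEMeasurable g μ) :
    (∫⁻ a, f a * g a ∂μ) ^ 2 ≤ (∫⁻ a, f a ^ 2 ∂μ) * ∫⁻ a, g a ^ 2 ∂μ := by
  have h := ENNReal.lintegral_mul_le_Lp_mul_Lq μ Real.HolderConjugate.two_two hf hg
  calc (∫⁻ a, f a * g a ∂μ) ^ 2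
      ≤ ((∫⁻ a, f a ^ (2:ℝ) ∂μ) ^ (1 / (2:ℝ)) * (∫⁻ a, g a ^ (2:ℝ) ∂μ) ^ (1 / (2:ℝ))) ^ 2 := by
        gcongr; exact h
    _ = _ := by
        simp only [ENNReal.rpow_two]
        rw [mul_pow, ← ENNReal.rpow_two, ← ENNReal.rpow_two, ← ENNReal.rpow_mul,
          ← ENNReal.rpow_mul]
        norm_num

theorem lintegral_triple_convolution (h : V → ENNReal) (hh : Measurable h) :
    ∫⁻ z, ∫⁻ x, ∫⁻ y, h x * h y * h (z - x - y) = (∫⁻ x, h x) ^ 3 := by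
  rw [lintegral_lintegral_swap (by fun_prop)]
  have h1 : ∀ x, ∫⁻ z, ∫⁻ y, h x * h y * h (z - x - y) = h x * (∫⁻ y, h y) ^ 2 := fun x => by
    rw [lintegral_lintegral_swap (by fun_prop)]
    have h2 : ∀ y, ∫⁻ z, h x * h y * h (z - x - y) = h x * (h y * ∫⁻ z, h z) := fun y => by
      rw [lintegral_const_mul _ (by fun_prop)]
      simp_rw [sub_sub]
      rw [lintegral_sub_right_eq_self h (x + y), mul_assoc]
    simp_rw [h2]
    rw [lintegral_const_mul _ (by fun_prop), lintegral_mul_const _ hh, sq]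
  simp_rw [h1]
  rw [lintegral_mul_const _ hh]
  ring

/-- If `|g| ≤ w h`, the sixth power of the `L⁶` norm of the inverse Fourier transform of `g` is
controlled by the supremum of the triple convolution of `w²` and the `L²` norm of `h`. -/
theorem lintegral_enorm_fourierInv_pow_six_le {g : V → ℂ} (hg : Integrable g)
    (hgm : Measurable g) {w h : V → ENNReal} (hw : Measurable w) (hh : Measurable h)
    (hgwh : ∀ x, ‖g x‖ₑ ≤ w x * h x) {K : ENNReal}
    (hK : ∀ z, ∫⁻ x, ∫⁻ y, w x ^ 2 * w y ^ 2 * w (z - x - y) ^ 2 ≤ K) :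
    ∫⁻ x, ‖𝓕⁻ g x‖ₑ ^ 6 ≤ K * (∫⁻ x, h x ^ 2) ^ 3 := by
  have hint : Integrable (convolution g g (ContinuousLinearMap.mul ℂ ℂ) volume) :=
    hg.integrable_convolution _ hg
  set G := convolution g (convolution g g (ContinuousLinearMap.mul ℂ ℂ) volume)
    (ContinuousLinearMap.mul ℂ ℂ) volume with hGdef
  have hG : Integrable G := hg.integrable_convolution _ hint
  have hFG : ∀ x, 𝓕⁻ G x = 𝓕⁻ g x ^ 3 := fun x => by
    rw [Real.fourierInv_eq_fourier_neg, Real.fourierInv_eq_fourier_neg, hGdef,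
      Real.fourier_mul_convolution_eq hg hint, Real.fourier_mul_convolution_eq hg hg]
    ring
  have hGz : ∀ z, ‖G z‖ₑ ≤ ∫⁻ x, ∫⁻ y, ‖g x‖ₑ * (‖g y‖ₑ * ‖g (z - x - y)‖ₑ) := fun z => by
    rw [hGdef, convolution]
    refine (enorm_integral_le_lintegral_enorm _).trans (lintegral_mono fun x => ?_)
    simp only [ContinuousLinearMap.mul_apply', enorm_mul]
    rw [lintegral_const_mul _ (by fun_prop)]
    gcongr
    rw [convolution]
    refine (enorm_integral_le_lintegral_enorm _).trans (lintegral_mono fun y => ?_)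
    simp [enorm_mul]
  calc ∫⁻ x, ‖𝓕⁻ g x‖ₑ ^ 6 = ∫⁻ x, ‖𝓕⁻ G x‖ₑ ^ 2 := by
        refine lintegral_congr fun x => ?_
        rw [hFG, enorm_pow, ← pow_mul]
    _ ≤ ∫⁻ z, ‖G z‖ₑ ^ 2 := lintegral_enorm_fourierInv_sq_le hG
    _ ≤ ∫⁻ z, K * ∫⁻ x, ∫⁻ y, h x ^ 2 * h y ^ 2 * h (z - x - y) ^ 2 := by
        refine lintegral_mono fun z => ?_
        calc ‖G z‖ₑ ^ 2
            ≤ (∫⁻ p : V × V, (w p.1 * w p.2 * w (z - p.1 - p.2)) *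
                (h p.1 * h p.2 * h (z - p.1 - p.2)) ∂(volume.prod volume)) ^ 2 := by
              gcongr
              refine (hGz z).trans ?_
              rw [lintegral_prod _ (by fun_prop)]
              refine lintegral_mono fun x => lintegral_mono fun y => ?_
              calc ‖g x‖ₑ * (‖g y‖ₑ * ‖g (z - x - y)‖ₑ)
                  ≤ (w x * h x) * ((w y * h y) * (w (z - x - y) * h (z - x - y))) := by
                    gcongr <;> exact hgwh _
                _ = _ := by ring
          _ ≤ _ := sq_lintegral_mul_le _ (by fun_prop) (by fun_prop)
          _ ≤ _ := by
              rw [lintegral_prod _ (by fun_prop), lintegral_prod _ (by fun_prop)]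
              simp only [mul_pow]
              gcongr
              exact hK z
    _ = _ := by
        have hm : Measurable fun z => ∫⁻ x, ∫⁻ y, h x ^ 2 * h y ^ 2 * h (z - x - y) ^ 2 := by
          fun_prop
        rw [lintegral_const_mul _ hm, lintegral_triple_convolution (fun x => h x ^ 2) (by fun_prop)]

end Plancherel

section Kernel

theorem lintegral_comp_mul_left_le (H : ℝ → ENNReal) (hH : Measurable H) {a : ℝ} (ha : 1 ≤ a) :
    ∫⁻ x, H (a * x) ≤ ∫⁻ x, H x := by
  have h0 : a ≠ 0 := by positivity
  rw [← lintegral_map (f := H) (g := fun x => a * x) hH (by fun_prop),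
    Real.map_volume_mul_left h0, lintegral_smul_measure]
  refine mul_le_of_le_one_left zero_le ?_
  rw [ENNReal.ofReal_le_one, abs_of_nonneg (by positivity)]
  exact inv_le_one_of_one_le₀ ha

theorem lintegral_sub_sq_add_sq_le (H : ℝ → ENNReal) (hH : Measurable H) (c : ℝ) :
    ∫⁻ x : ℝ, ∫⁻ y : ℝ, H (c - (x ^ 2 + y ^ 2)) ≤
      ENNReal.ofReal (2 * Real.pi) * ∫⁻ x, H x := by
  rw [← lintegral_prod (fun p : ℝ × ℝ => H (c - (p.1 ^ 2 + p.2 ^ 2))) (by fun_prop),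
    ← Measure.volume_eq_prod, ← lintegral_comp_polarCoord_symm]
  have h1 : ∀ p : ℝ × ℝ, ENNReal.ofReal p.1 • H (c - ((polarCoord.symm p).1 ^ 2 +
      (polarCoord.symm p).2 ^ 2)) = ENNReal.ofReal p.1 * H (c - p.1 ^ 2) := fun p => by
    rw [polarCoord_symm_apply, smul_eq_mul]
    congr 3
    nlinarith [Real.sin_sq_add_cos_sq p.2]
  simp_rw [h1]
  rw [polarCoord_target, Measure.volume_eq_prod, ← Measure.prod_restrict,
    lintegral_prod _ (by fun_prop)]
  simp only [lintegral_const, Measure.restrict_apply_univ, Real.volume_Ioo]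
  rw [lintegral_mul_const _ (by fun_prop), mul_comm]
  have h2 : Real.pi - -Real.pi = 2 * Real.pi := by ring
  rw [h2]
  refine mul_le_mul' le_rfl ?_
  calc ∫⁻ r in Ioi (0 : ℝ), ENNReal.ofReal r * H (c - r ^ 2)
      ≤ ∫⁻ r in Ioi (0 : ℝ), ENNReal.ofReal |-(2 * r)| * H (c - r ^ 2) := by
        refine setLIntegral_mono' measurableSet_Ioi fun r hr => ?_
        gcongr
        rw [abs_neg, abs_of_pos (by simpa using hr)]
        have : (0 : ℝ) < r := hr
        linarith
    _ = ∫⁻ x in (fun r => c - r ^ 2) '' Ioi (0 : ℝ), H x := by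
        refine (lintegral_image_eq_lintegral_abs_deriv_mul measurableSet_Ioi
          (f := fun r => c - r ^ 2) (f' := fun r => -(2 * r)) (fun r _ => ?_) ?_ H).symm
        · simpa using ((hasDerivAt_pow 2 r).const_sub c).hasDerivWithinAt
        · intro x hx y hy hxy
          have hx' : (0 : ℝ) < x := hx
          have hy' : (0 : ℝ) < y := hy
          have : x ^ 2 = y ^ 2 := by simpa using hxy
          exact (pow_left_inj₀ hx'.le hy'.le two_ne_zero).1 this
    _ ≤ ∫⁻ x, H x := setLIntegral_le_lintegral _ _

theorem lintegral_sub_three_sq_le (H : ℝ → ENNReal) (hH : Measurable H) (a c : ℝ) :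
    ∫⁻ x : ℝ, ∫⁻ y : ℝ, H (c - (x ^ 2 + y ^ 2 + (a - x - y) ^ 2)) ≤
      ENNReal.ofReal (2 * Real.pi) * ∫⁻ x, H x := by
  have h32 : √(3 / 2) ^ 2 = 3 / 2 := Real.sq_sqrt (by norm_num)
  have h2 : √2 ^ 2 = 2 := Real.sq_sqrt (by norm_num)
  calc ∫⁻ x : ℝ, ∫⁻ y : ℝ, H (c - (x ^ 2 + y ^ 2 + (a - x - y) ^ 2))
      = ∫⁻ x : ℝ, ∫⁻ y : ℝ,
          H (c - a ^ 2 / 3 - ((√(3 / 2) * (x + -(a / 3))) ^ 2 + (√2 * y) ^ 2)) := by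
        refine lintegral_congr fun x => ?_
        rw [← lintegral_add_right_eq_self (fun y => H (c - (x ^ 2 + y ^ 2 + (a - x - y) ^ 2)))
          ((a - x) / 2)]
        refine lintegral_congr fun y => ?_
        congr 1
        rw [mul_pow, mul_pow, h32, h2]
        ring
    _ = ∫⁻ x : ℝ, ∫⁻ y : ℝ, H (c - a ^ 2 / 3 - ((√(3 / 2) * x) ^ 2 + (√2 * y) ^ 2)) :=
        lintegral_add_right_eq_self (fun x => ∫⁻ y : ℝ,
          H (c - a ^ 2 / 3 - ((√(3 / 2) * x) ^ 2 + (√2 * y) ^ 2))) _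
    _ ≤ ∫⁻ x : ℝ, ∫⁻ y : ℝ, H (c - a ^ 2 / 3 - (x ^ 2 + (√2 * y) ^ 2)) :=
        lintegral_comp_mul_left_le (fun x => ∫⁻ y : ℝ,
          H (c - a ^ 2 / 3 - (x ^ 2 + (√2 * y) ^ 2))) (by fun_prop)
          (Real.one_le_sqrt.2 (by norm_num))
    _ ≤ ∫⁻ x : ℝ, ∫⁻ y : ℝ, H (c - a ^ 2 / 3 - (x ^ 2 + y ^ 2)) :=
        lintegral_mono fun x => lintegral_comp_mul_left_le (fun y =>
          H (c - a ^ 2 / 3 - (x ^ 2 + y ^ 2))) (by fun_prop) (Real.one_le_sqrt.2 (by norm_num))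
    _ ≤ _ := lintegral_sub_sq_add_sq_le H hH _

/-- The volume-preserving identification of `ℝ³` with `ℝ × ℝ²`. -/
def consEquiv : Rn 3 ≃ᵐ ℝ × (Fin 2 → ℝ) :=
  (MeasurableEquiv.toLp 2 (Fin 3 → ℝ)).symm.trans
    (MeasurableEquiv.piFinSuccAbove (fun _ : Fin 3 => ℝ) 0)

theorem measurePreserving_consEquiv : MeasurePreserving consEquiv :=
  (EuclideanSpace.volume_preserving_symm_measurableEquiv_toLp (Fin 3)).trans
    (volume_preserving_piFinSuccAbove (fun _ : Fin 3 => ℝ) 0)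

theorem lintegral_comp_consEquiv (f : ℝ → (Fin 2 → ℝ) → ENNReal)
    (hf : Measurable (Function.uncurry f)) :
    ∫⁻ ξ : Rn 3, f (ξ 0) (fun i => ξ i.succ) = ∫⁻ p, ∫⁻ x, f x p := by
  rw [lintegral_lintegral_swap (by exact (hf.comp measurable_swap).aemeasurable)]
  exact (measurePreserving_consEquiv.lintegral_comp hf).trans
    (lintegral_prod (Function.uncurry f) hf.aemeasurable)

theorem lintegral_resonance_pair_le (v : Rn 3 → ENNReal) (v' : (Fin 2 → ℝ) → ENNReal)
    (hv' : Measurable v') (hv : ∀ ξ : Rn 3, v ξ ≤ v' fun i => ξ i.succ)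
    (H : ℝ → ENNReal) (hH : Measurable H) (ξ : Rn 3) (c : ℝ) :
    ∫⁻ ξ₁, ∫⁻ ξ₂, v ξ₁ * v ξ₂ * H (c - (‖ξ₁‖ ^ 2 + ‖ξ₂‖ ^ 2 + ‖ξ - ξ₁ - ξ₂‖ ^ 2)) ≤
      ENNReal.ofReal (2 * Real.pi) * (∫⁻ p, v' p) ^ 2 * ∫⁻ x, H x := by
  set q : (Fin 2 → ℝ) → (Fin 2 → ℝ) → ℝ := fun p₁ p₂ =>
    c - (∑ i, p₁ i ^ 2 + ∑ i, p₂ i ^ 2 + ∑ i : Fin 2, (ξ i.succ - p₁ i - p₂ i) ^ 2) with hq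
  have hqm : Measurable (Function.uncurry q) := by
    simp only [hq, Function.uncurry_def]; fun_prop
  calc ∫⁻ ξ₁, ∫⁻ ξ₂, v ξ₁ * v ξ₂ * H (c - (‖ξ₁‖ ^ 2 + ‖ξ₂‖ ^ 2 + ‖ξ - ξ₁ - ξ₂‖ ^ 2))
      ≤ ∫⁻ ξ₁ : Rn 3, ∫⁻ ξ₂ : Rn 3, v' (fun i => ξ₁ i.succ) * v' (fun i => ξ₂ i.succ) *
          H (q (fun i => ξ₁ i.succ) (fun i => ξ₂ i.succ) -
            (ξ₁ 0 ^ 2 + ξ₂ 0 ^ 2 + (ξ 0 - ξ₁ 0 - ξ₂ 0) ^ 2)) := by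
        refine lintegral_mono fun ξ₁ => lintegral_mono fun ξ₂ => ?_
        refine mul_le_mul' (mul_le_mul' (hv _) (hv _)) (le_of_eq ?_)
        congr 1
        simp only [hq, EuclideanSpace.real_norm_sq_eq, Fin.sum_univ_succ]
        simp
        ring
    _ = ∫⁻ p₁, ∫⁻ x₁, ∫⁻ p₂, ∫⁻ x₂, v' p₁ * v' p₂ *
          H (q p₁ p₂ - (x₁ ^ 2 + x₂ ^ 2 + (ξ 0 - x₁ - x₂) ^ 2)) := by
        have h1 : ∀ p₁ x₁, ∫⁻ ξ₂ : Rn 3, v' p₁ * v' (fun i => ξ₂ i.succ) *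
          H (q p₁ (fun i => ξ₂ i.succ) - (x₁ ^ 2 + ξ₂ 0 ^ 2 + (ξ 0 - x₁ - ξ₂ 0) ^ 2)) =
          ∫⁻ p₂, ∫⁻ x₂, v' p₁ * v' p₂ *
          H (q p₁ p₂ - (x₁ ^ 2 + x₂ ^ 2 + (ξ 0 - x₁ - x₂) ^ 2)) := fun p₁ x₁ =>
          lintegral_comp_consEquiv (fun x₂ p₂ => v' p₁ * v' p₂ *
            H (q p₁ p₂ - (x₁ ^ 2 + x₂ ^ 2 + (ξ 0 - x₁ - x₂) ^ 2)))
            (by simp only [Function.uncurry_def]; fun_prop)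
        rw [← lintegral_comp_consEquiv]
        · exact lintegral_congr fun ξ₁ => h1 _ _
        · simp only [Function.uncurry_def]; fun_prop
    _ ≤ ∫⁻ p₁, ∫⁻ p₂, v' p₁ * v' p₂ * (ENNReal.ofReal (2 * Real.pi) * ∫⁻ x, H x) := by
        refine lintegral_mono fun p₁ => ?_
        rw [lintegral_lintegral_swap (by fun_prop)]
        refine lintegral_mono fun p₂ => ?_
        have h2 : ∀ x₁, ∫⁻ x₂, v' p₁ * v' p₂ *
            H (q p₁ p₂ - (x₁ ^ 2 + x₂ ^ 2 + (ξ 0 - x₁ - x₂) ^ 2)) = v' p₁ * v' p₂ *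
            ∫⁻ x₂, H (q p₁ p₂ - (x₁ ^ 2 + x₂ ^ 2 + (ξ 0 - x₁ - x₂) ^ 2)) := fun x₁ =>
          lintegral_const_mul _ (by fun_prop)
        simp_rw [h2]
        rw [lintegral_const_mul _ (by fun_prop)]
        gcongr
        exact lintegral_sub_three_sq_le H hH _ _
    _ = _ := by
        have h3 : ∀ p₁, ∫⁻ p₂, v' p₁ * v' p₂ * (ENNReal.ofReal (2 * Real.pi) * ∫⁻ x, H x) =
            v' p₁ * ((∫⁻ p, v' p) * (ENNReal.ofReal (2 * Real.pi) * ∫⁻ x, H x)) := fun p₁ => by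
          rw [lintegral_mul_const _ (by fun_prop), lintegral_const_mul _ hv', mul_assoc]
        simp_rw [h3]
        rw [lintegral_mul_const _ hv']
        ring

theorem mul_mul_le_pow_three_add (x y z : ENNReal) : x * y * z ≤ x ^ 3 + y ^ 3 + z ^ 3 := by
  have h : ∀ m : ENNReal, x ≤ m → y ≤ m → z ≤ m → x * y * z ≤ m ^ 3 := fun m hx hy hz =>
    (mul_le_mul' (mul_le_mul' hx hy) hz).trans_eq (by ring)
  rcases le_total x y with hxy | hxy
  · rcases le_total y z with hyz | hyz
    · exact (h z (hxy.trans hyz) hyz le_rfl).trans le_add_self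
    · exact (h y hxy le_rfl hyz).trans (le_add_self.trans le_self_add)
  · rcases le_total x z with hxz | hxz
    · exact (h z hxz (hxy.trans hxz) le_rfl).trans le_add_self
    · exact (h x le_rfl hxy hxz).trans (le_self_add.trans le_self_add)

/-- The space-time `ℝ³ × ℝ` with its Euclidean structure. -/
abbrev SpaceTime := WithLp 2 (Rn 3 × ℝ)

theorem lintegral_spaceTime (f : Rn 3 → ℝ → ENNReal) (hf : Measurable (Function.uncurry f)) :
    ∫⁻ p : SpaceTime, f p.fst p.snd = ∫⁻ ξ, ∫⁻ τ, f ξ τ := by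
  exact ((WithLp.volume_preserving_ofLp (Rn 3) ℝ).lintegral_comp hf).trans
    (lintegral_prod (Function.uncurry f) hf.aemeasurable)

theorem lintegral_resonance_le (A : Rn 3 → ENNReal) (hA : Measurable A)
    (v' : (Fin 2 → ℝ) → ENNReal)
    (hv' : Measurable v') (hv : ∀ ξ : Rn 3, A ξ ^ 3 ≤ v' fun i => ξ i.succ)
    (H : ℝ → ENNReal) (hH : Measurable H) (z : SpaceTime) :
    ∫⁻ x : SpaceTime, ∫⁻ y : SpaceTime,
      (A x.fst ^ 2 * H (x.snd - ‖x.fst‖ ^ 2)) * (A y.fst ^ 2 * H (y.snd - ‖y.fst‖ ^ 2)) *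
        (A (z.fst - x.fst - y.fst) ^ 2 *
          H (z.snd - x.snd - y.snd - ‖z.fst - x.fst - y.fst‖ ^ 2)) ≤
      3 * (ENNReal.ofReal (2 * Real.pi) * (∫⁻ p, v' p) ^ 2 * (∫⁻ x, H x) ^ 3) := by
  set v : Rn 3 → ENNReal := fun ξ => A ξ ^ 3 with hvdef
  set ξ := z.fst
  set τ := z.snd
  set HH : ℝ → ENNReal := fun c => ∫⁻ σ₁, ∫⁻ σ₂, H σ₁ * H σ₂ * H (c - σ₁ - σ₂) with hHH
  have hHHm : Measurable HH := by simp only [hHH]; fun_prop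
  have hpair := lintegral_resonance_pair_le v v' hv' hv HH hHHm ξ τ
  rw [lintegral_triple_convolution H hH] at hpair
  set M := ENNReal.ofReal (2 * Real.pi) * (∫⁻ p, v' p) ^ 2 * (∫⁻ x, H x) ^ 3
  set R : Rn 3 → Rn 3 → ENNReal := fun ξ₁ ξ₂ =>
    HH (τ - (‖ξ₁‖ ^ 2 + ‖ξ₂‖ ^ 2 + ‖ξ - ξ₁ - ξ₂‖ ^ 2)) with hR
  have hRm : Measurable (Function.uncurry R) := by
    simp only [hR, Function.uncurry_def]; fun_prop
  have hvm : Measurable v := hA.pow_const 3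
  have hpair2 : ∫⁻ ξ₁, ∫⁻ ξ₂, v ξ₁ * v (ξ - ξ₁ - ξ₂) * R ξ₁ ξ₂ ≤ M := by
    refine le_trans (le_of_eq ?_) hpair
    refine lintegral_congr fun ξ₁ => ?_
    rw [← lintegral_sub_left_eq_self _ (ξ - ξ₁)]
    refine lintegral_congr fun ξ₂ => ?_
    simp only [hR, sub_sub_cancel]
    congr 3
    ring
  have hpair3 : ∫⁻ ξ₁, ∫⁻ ξ₂, v ξ₂ * v (ξ - ξ₁ - ξ₂) * R ξ₁ ξ₂ ≤ M := by
    refine le_trans (le_of_eq ?_) hpair2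
    rw [lintegral_lintegral_swap (by fun_prop)]
    refine lintegral_congr fun ξ₁ => lintegral_congr fun ξ₂ => ?_
    simp only [hR, sub_right_comm ξ ξ₂ ξ₁]
    congr 3
    ring
  calc _ = ∫⁻ ξ₁, ∫⁻ τ₁, ∫⁻ ξ₂, ∫⁻ τ₂,
      (A ξ₁ ^ 2 * H (τ₁ - ‖ξ₁‖ ^ 2)) * (A ξ₂ ^ 2 * H (τ₂ - ‖ξ₂‖ ^ 2)) *
        (A (ξ - ξ₁ - ξ₂) ^ 2 * H (τ - τ₁ - τ₂ - ‖ξ - ξ₁ - ξ₂‖ ^ 2)) := by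
        rw [← lintegral_spaceTime]
        · refine lintegral_congr fun x => ?_
          rw [← lintegral_spaceTime]
          simp only [Function.uncurry_def]; fun_prop
        · simp only [Function.uncurry_def]; fun_prop
    _ = ∫⁻ ξ₁, ∫⁻ ξ₂, (A ξ₁ ^ 2 * A ξ₂ ^ 2 * A (ξ - ξ₁ - ξ₂) ^ 2) * R ξ₁ ξ₂ := by
        refine lintegral_congr fun ξ₁ => ?_
        rw [lintegral_lintegral_swap (by fun_prop)]
        refine lintegral_congr fun ξ₂ => ?_
        simp only [hR, hHH]
        rw [← lintegral_const_mul _ (by fun_prop),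
          ← lintegral_add_right_eq_self _ (‖ξ₁‖ ^ 2)]
        refine lintegral_congr fun τ₁ => ?_
        rw [← lintegral_const_mul _ (by fun_prop),
          ← lintegral_add_right_eq_self _ (‖ξ₂‖ ^ 2)]
        refine lintegral_congr fun τ₂ => ?_
        simp only [add_sub_cancel_right]
        have : τ - (τ₁ + ‖ξ₁‖ ^ 2) - (τ₂ + ‖ξ₂‖ ^ 2) - ‖ξ - ξ₁ - ξ₂‖ ^ 2 =
          τ - (‖ξ₁‖ ^ 2 + ‖ξ₂‖ ^ 2 + ‖ξ - ξ₁ - ξ₂‖ ^ 2) - τ₁ - τ₂ := by ring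
        rw [this]
        ring
    _ ≤ ∫⁻ ξ₁, ∫⁻ ξ₂, (v ξ₁ * v ξ₂ * R ξ₁ ξ₂ + v ξ₁ * v (ξ - ξ₁ - ξ₂) * R ξ₁ ξ₂ +
          v ξ₂ * v (ξ - ξ₁ - ξ₂) * R ξ₁ ξ₂) := by
        refine lintegral_mono fun ξ₁ => lintegral_mono fun ξ₂ => ?_
        rw [← add_mul, ← add_mul]
        gcongr
        refine le_trans (le_of_eq ?_) ((mul_mul_le_pow_three_add (A ξ₁ * A ξ₂)
          (A ξ₁ * A (ξ - ξ₁ - ξ₂)) (A ξ₂ * A (ξ - ξ₁ - ξ₂))).trans (le_of_eq ?_))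
        · ring
        · simp only [hvdef]; ring
    _ = (∫⁻ ξ₁, ∫⁻ ξ₂, v ξ₁ * v ξ₂ * R ξ₁ ξ₂) +
          (∫⁻ ξ₁, ∫⁻ ξ₂, v ξ₁ * v (ξ - ξ₁ - ξ₂) * R ξ₁ ξ₂) +
          ∫⁻ ξ₁, ∫⁻ ξ₂, v ξ₂ * v (ξ - ξ₁ - ξ₂) * R ξ₁ ξ₂ := by
        rw [← lintegral_add_left (by fun_prop), ← lintegral_add_left (by fun_prop)]
        refine lintegral_congr fun ξ₁ => ?_
        rw [← lintegral_add_left (by fun_prop), ← lintegral_add_left (by fun_prop)]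
    _ ≤ M + M + M := add_le_add (add_le_add hpair hpair2) hpair3
    _ = 3 * M := by ring

end Kernel

section Weights

theorem jap_pos {n : ℕ} (ξ : Rn n) : 0 < jap ξ := Real.sqrt_pos.2 (by positivity)

theorem japR_pos (x : ℝ) : 0 < japR x := Real.sqrt_pos.2 (by positivity)

theorem jap_rpow {n : ℕ} (ξ : Rn n) (r : ℝ) : jap ξ ^ r = (1 + ‖ξ‖ ^ 2) ^ (r / 2) := by
  rw [jap, Real.sqrt_eq_rpow, ← Real.rpow_mul (by positivity)]
  congr 1; ring

theorem japR_rpow (x : ℝ) (r : ℝ) : japR x ^ r = (1 + ‖x‖ ^ 2) ^ (r / 2) := by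
  rw [japR, Real.sqrt_eq_rpow, ← Real.rpow_mul (by positivity), Real.norm_eq_abs, sq_abs]
  congr 1; ring

@[fun_prop]
theorem continuous_jap {n : ℕ} : Continuous (jap (n := n)) := by unfold jap; fun_prop

@[fun_prop]
theorem continuous_japR : Continuous japR := by unfold japR; fun_prop

theorem lintegral_japR_rpow_lt_top {b : ℝ} (hb : 1 / 2 < b) :
    ∫⁻ τ, ENNReal.ofReal (japR τ ^ (-(2 * b))) < ⊤ := by
  have h : Integrable (fun x : ℝ => (1 + ‖x‖ ^ 2) ^ (-(2 * b) / 2)) :=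
    integrable_rpow_neg_one_add_norm_sq (by simp; linarith)
  simp_rw [japR_rpow]
  exact h.lintegral_lt_top

/-- The reciprocal of the `X_{s,b}` weight. -/
def xWeight (s b : ℝ) (p : SpaceTime) : ENNReal :=
  ENNReal.ofReal (jap p.fst ^ (-s) * japR (p.snd - ‖p.fst‖ ^ 2) ^ (-b))

@[fun_prop]
theorem continuous_spaceTime_fst : Continuous fun p : SpaceTime => p.fst :=
  continuous_fst.comp (WithLp.prod_continuous_ofLp 2 _ _)

@[fun_prop]
theorem continuous_spaceTime_snd : Continuous fun p : SpaceTime => p.snd :=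
  continuous_snd.comp (WithLp.prod_continuous_ofLp 2 _ _)

@[fun_prop]
theorem measurable_xWeight (s b : ℝ) : Measurable (xWeight s b) := by
  unfold xWeight
  have h1 : Measurable fun p : SpaceTime => p.fst := continuous_spaceTime_fst.measurable
  have h2 : Measurable fun p : SpaceTime => p.snd := continuous_spaceTime_snd.measurable
  have h3 : Measurable (jap (n := 3)) := continuous_jap.measurable
  have h4 : Measurable japR := continuous_japR.measurable
  fun_prop

theorem exists_lintegral_xWeight_le {s b : ℝ} (hs : 5 / 6 < s) (hb : 1 / 2 < b) :
    ∃ K : ENNReal, K < ⊤ ∧ ∀ z : SpaceTime, ∫⁻ x : SpaceTime, ∫⁻ y : SpaceTime,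
      xWeight s b x ^ 2 * xWeight s b y ^ 2 * xWeight s b (z - x - y) ^ 2 ≤ K := by
  set A : Rn 3 → ENNReal := fun ξ => ENNReal.ofReal (jap ξ ^ (-s)) with hA
  set H : ℝ → ENNReal := fun τ => ENNReal.ofReal (japR τ ^ (-(2 * b))) with hH
  set v' : (Fin 2 → ℝ) → ENNReal := fun p => ENNReal.ofReal ((1 + ‖p‖ ^ 2) ^ (-(3 * s) / 2))
    with hv'
  have hAm : Measurable A := by
    have h3 : Measurable (jap (n := 3)) := continuous_jap.measurable
    fun_prop
  have hHm : Measurable H := by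
    have h4 : Measurable japR := continuous_japR.measurable
    fun_prop
  have hw : ∀ p, xWeight s b p ^ 2 = A p.fst ^ 2 * H (p.snd - ‖p.fst‖ ^ 2) := fun p => by
    have h1 := japR_pos (p.snd - ‖p.fst‖ ^ 2)
    simp only [xWeight, hA, hH]
    rw [ENNReal.ofReal_mul (by have := jap_pos p.fst; positivity), mul_pow]
    congr 1
    rw [← ENNReal.ofReal_pow (by positivity), ← Real.rpow_natCast, ← Real.rpow_mul h1.le]
    congr 2
    push_cast; ring
  have hAv : ∀ ξ : Rn 3, A ξ ^ 3 ≤ v' fun i => ξ i.succ := fun ξ => by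
    have h1 := jap_pos ξ
    simp only [hA, hv']
    rw [← ENNReal.ofReal_pow (by positivity), ← Real.rpow_natCast, ← Real.rpow_mul h1.le,
      jap_rpow]
    apply ENNReal.ofReal_le_ofReal
    have h2 : -s * ((3 : ℕ) : ℝ) / 2 = -(3 * s) / 2 := by push_cast; ring
    rw [h2]
    apply Real.rpow_le_rpow_of_nonpos (by positivity) _ (by linarith)
    gcongr
    exact (pi_norm_le_iff_of_nonneg (norm_nonneg _)).2 fun i => PiLp.norm_apply_le ξ i.succ
  refine ⟨3 * (ENNReal.ofReal (2 * Real.pi) * (∫⁻ p, v' p) ^ 2 * (∫⁻ x, H x) ^ 3), ?_,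
    fun z => ?_⟩
  · have h : Integrable (fun x : Fin 2 → ℝ => (1 + ‖x‖ ^ 2) ^ (-(3 * s) / 2)) :=
      integrable_rpow_neg_one_add_norm_sq (by simp; linarith)
    have h1 : ∫⁻ p, v' p < ⊤ := h.lintegral_lt_top
    have h2 : ∫⁻ x, H x < ⊤ := lintegral_japR_rpow_lt_top hb
    finiteness
  · simp only [hw]
    exact lintegral_resonance_le A hAm v' (by fun_prop) hAv H hHm z

end Weights

section SpaceTime
open scoped SchwartzMap

variable {E : Type*} [NormedAddCommGroup E]

/-- The point of space-time with spatial part `x` and temporal part `t`. -/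
abbrev stPt (x : Rn 3) (t : ℝ) : SpaceTime := WithLp.toLp 2 (x, t)

theorem norm_sq_stPt (x : Rn 3) (t : ℝ) : ‖stPt x t‖ ^ 2 = ‖x‖ ^ 2 + t ^ 2 := by
  rw [WithLp.prod_norm_sq_eq_of_L2]
  simp

theorem inner_stPt (x ξ : Rn 3) (t τ : ℝ) : ⟪stPt x t, stPt ξ τ⟫ = ⟪x, ξ⟫ + t * τ := by
  rw [WithLp.prod_inner_apply]
  simp [mul_comm]

theorem integrable_prod_spaceTime {f : SpaceTime → E} (hf : Integrable f) :
    Integrable (fun q : Rn 3 × ℝ => f (stPt q.1 q.2)) (volume.prod volume) :=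
  (WithLp.volume_preserving_toLp (Rn 3) ℝ).integrable_comp_of_integrable hf

variable [NormedSpace ℝ E]

theorem integral_spaceTime {f : SpaceTime → E} (hf : Integrable f) :
    ∫ p, f p = ∫ ξ, ∫ τ, f (stPt ξ τ) := by
  rw [← integral_prod (fun q : Rn 3 × ℝ => f (stPt q.1 q.2)) (integrable_prod_spaceTime hf),
    ← Measure.volume_eq_prod]
  exact ((WithLp.volume_preserving_toLp (Rn 3) ℝ).integral_comp
    (MeasurableEquiv.toLp 2 (Rn 3 × ℝ)).measurableEmbedding f).symm

theorem hasTemperateGrowth_stPt_left (t : ℝ) :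
    Function.HasTemperateGrowth fun x => stPt x t := by
  have h : (fun x => stPt x t) = ⇑((WithLp.prodContinuousLinearEquiv 2 ℝ (Rn 3)
      ℝ).symm.toContinuousLinearMap ∘L ContinuousLinearMap.inl ℝ (Rn 3) ℝ) + fun _ => stPt 0 t := by
    ext x : 1
    simp [stPt, ← WithLp.toLp_add]
  rw [h]
  exact (ContinuousLinearMap.hasTemperateGrowth _).add (Function.HasTemperateGrowth.const _)

theorem hasTemperateGrowth_stPt_right (ξ : Rn 3) :
    Function.HasTemperateGrowth fun t => stPt ξ t := by
  have h : (fun t => stPt ξ t) = ⇑((WithLp.prodContinuousLinearEquiv 2 ℝ (Rn 3)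
      ℝ).symm.toContinuousLinearMap ∘L ContinuousLinearMap.inr ℝ (Rn 3) ℝ) + fun _ => stPt ξ 0 := by
    ext x : 1
    simp [stPt, ← WithLp.toLp_add]
  rw [h]
  exact (ContinuousLinearMap.hasTemperateGrowth _).add (Function.HasTemperateGrowth.const _)

theorem antilipschitzWith_stPt_left (t : ℝ) : AntilipschitzWith 1 fun x => stPt x t := by
  refine AntilipschitzWith.of_le_mul_dist fun x y => ?_
  rw [dist_eq_norm, dist_eq_norm, ← WithLp.toLp_sub, NNReal.coe_one, one_mul]
  refine le_of_sq_le_sq ?_ (norm_nonneg _)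
  rw [norm_sq_stPt]
  simp

theorem antilipschitzWith_stPt_right (ξ : Rn 3) : AntilipschitzWith 1 fun t => stPt ξ t := by
  refine AntilipschitzWith.of_le_mul_dist fun x y => ?_
  rw [dist_eq_norm, dist_eq_norm, ← WithLp.toLp_sub, NNReal.coe_one, one_mul]
  refine le_of_sq_le_sq ?_ (norm_nonneg _)
  rw [norm_sq_stPt]
  simp

end SpaceTime

section Slices
open scoped SchwartzMap

variable {E : Type*} [NormedAddCommGroup E] [NormedSpace ℂ E]

/-- The restriction of a space-time Schwartz function to a fixed time. -/
def spaceSlice (f : 𝓢(SpaceTime, E)) (t : ℝ) : 𝓢(Rn 3, E) :=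
  SchwartzMap.compCLMOfAntilipschitz ℂ (hasTemperateGrowth_stPt_left t)
    (antilipschitzWith_stPt_left t) f

/-- The restriction of a space-time Schwartz function to a fixed position. -/
def timeSlice (f : 𝓢(SpaceTime, E)) (ξ : Rn 3) : 𝓢(ℝ, E) :=
  SchwartzMap.compCLMOfAntilipschitz ℂ (hasTemperateGrowth_stPt_right ξ)
    (antilipschitzWith_stPt_right ξ) f

@[simp] theorem spaceSlice_apply (f : 𝓢(SpaceTime, E)) (t : ℝ) (x : Rn 3) :
    spaceSlice f t x = f (stPt x t) := rfl

@[simp] theorem timeSlice_apply (f : 𝓢(SpaceTime, E)) (ξ : Rn 3) (t : ℝ) :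
    timeSlice f ξ t = f (stPt ξ t) := rfl

theorem norm_cexp_ofReal_mul_I_smul (a : ℝ) (v : E) : ‖cexp (a * I) • v‖ = ‖v‖ := by
  rw [norm_smul, norm_exp_ofReal_mul_I, one_mul]

theorem exists_norm_stPt_le (f : 𝓢(SpaceTime, E)) :
    ∃ C : ℝ, ∀ x t, ‖f (stPt x t)‖ ≤ C * (1 + ‖x‖) ^ (-(4 : ℝ)) := by
  refine ⟨2 ^ 4 * ((Finset.Iic (4, 0)).sup fun m => SchwartzMap.seminorm ℝ m.1 m.2) f,
    fun x t => ?_⟩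
  have h := SchwartzMap.one_add_le_sup_seminorm_apply (𝕜 := ℝ) (m := (4, 0)) (k := 4) (n := 0)
    le_rfl le_rfl f (stPt x t)
  rw [norm_iteratedFDeriv_zero] at h
  rw [Real.rpow_neg (by positivity), ← div_eq_mul_inv, le_div_iff₀ (by positivity), mul_comm]
  refine le_trans ?_ h
  have h1 : ‖x‖ ≤ ‖stPt x t‖ := by
    refine le_of_sq_le_sq ?_ (norm_nonneg _)
    rw [norm_sq_stPt]
    nlinarith [sq_nonneg t]
  norm_cast
  gcongr

variable [CompleteSpace E]

theorem fourier_spaceSlice (f : 𝓢(SpaceTime, E)) (t : ℝ) (ξ : Rn 3) :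
    𝓕 ⇑(spaceSlice f t) ξ = 𝓕⁻ (fun τ => 𝓕 f (stPt ξ τ)) t := by
  set k : ℝ → E := fun t => 𝓕 ⇑(spaceSlice f t) ξ with hk
  have hk' : ∀ t, k t = ∫ x, cexp (↑(-2 * Real.pi * ⟪x, ξ⟫) * I) • f (stPt x t) := fun t => by
    simp only [hk, Real.fourier_eq', spaceSlice_apply]
  have hcont : Continuous k := by
    obtain ⟨C, hC⟩ := exists_norm_stPt_le f
    rw [show k = fun t => ∫ x, cexp (↑(-2 * Real.pi * ⟪x, ξ⟫) * I) • f (stPt x t) from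
      funext hk']
    refine continuous_of_dominated (bound := fun x => C * (1 + ‖x‖) ^ (-(4 : ℝ))) (fun t => ?_)
      (fun t => .of_forall fun x => ?_) ?_ (.of_forall fun x => ?_)
    · exact Continuous.aestronglyMeasurable
        (by have := (spaceSlice f t).continuous; simp only [← spaceSlice_apply]; fun_prop)
    · rw [norm_cexp_ofReal_mul_I_smul]
      exact hC x t
    · exact (integrable_one_add_norm (by simp; norm_num)).const_mul _
    · have := (timeSlice f x).continuous
      simp only [← timeSlice_apply]; fun_prop
  have hint : Integrable (fun q : Rn 3 × ℝ =>
      cexp (↑(-2 * Real.pi * ⟪q.1, ξ⟫) * I) • f (stPt q.1 q.2)) (volume.prod volume) := by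
    refine (integrable_prod_spaceTime f.integrable).mono ?_ (.of_forall fun q => ?_)
    · refine AEStronglyMeasurable.smul (Continuous.aestronglyMeasurable (by fun_prop))
        (integrable_prod_spaceTime f.integrable).aestronglyMeasurable
    · rw [norm_cexp_ofReal_mul_I_smul]
  have hkint : Integrable k := by
    rw [show k = fun t => ∫ x, cexp (↑(-2 * Real.pi * ⟪x, ξ⟫) * I) • f (stPt x t) from
      funext hk']
    exact hint.integral_prod_right
  have hFk : 𝓕 k = fun τ => 𝓕 f (stPt ξ τ) := by
    ext τ
    have hint2 : Integrable (fun p : SpaceTime =>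
        cexp (↑(-2 * Real.pi * ⟪p, stPt ξ τ⟫) * I) • f p) := by
      refine f.integrable.mono (Continuous.aestronglyMeasurable (by
        have := f.continuous; fun_prop)) (.of_forall fun q => ?_)
      rw [norm_cexp_ofReal_mul_I_smul]
    have hint3 := integrable_prod_spaceTime hint2
    rw [SchwartzMap.fourier_coe, Real.fourier_eq', Real.fourier_eq', integral_spaceTime hint2,
      integral_integral_swap hint3]
    refine integral_congr_ae (.of_forall fun t => ?_)
    simp only [hk', inner_stPt]
    rw [← integral_smul]
    refine integral_congr_ae (.of_forall fun x => ?_)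
    simp only [smul_smul, ← Complex.exp_add]
    congr 2
    simp
    ring
  have h := hcont.fourierInv_fourier_eq hkint (by
    rw [hFk]; exact (timeSlice (𝓕 f) ξ).integrable)
  rw [hFk] at h
  exact (congrFun h t).symm

end Slices

section XNormSection
open scoped SchwartzMap

variable {E : Type*} [NormedAddCommGroup E] [NormedSpace ℂ E]

theorem stFourier_eq (f : 𝓢(SpaceTime, E)) (ξ : Rn 3) (τ : ℝ) :
    stFourier 3 (fun x t => f (stPt x t)) ξ τ = 𝓕 f (stPt ξ τ) := by
  have hint : Integrable (fun p : SpaceTime =>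
      cexp (↑(-2 * Real.pi * ⟪p, stPt ξ τ⟫) * I) • f p) := by
    refine f.integrable.mono (Continuous.aestronglyMeasurable (by
      have := f.continuous; fun_prop)) (.of_forall fun q => ?_)
    rw [norm_cexp_ofReal_mul_I_smul]
  rw [SchwartzMap.fourier_coe, Real.fourier_eq', integral_spaceTime hint, stFourier]
  simp only [inner_stPt, mul_comm I]

theorem one_le_japR (x : ℝ) : 1 ≤ japR x := Real.one_le_sqrt.2 (by nlinarith [sq_nonneg x])

theorem japR_le_one_add_abs (x : ℝ) : japR x ≤ 1 + |x| := by
  rw [japR, Real.sqrt_le_left (by positivity)]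
  nlinarith [sq_abs x, abs_nonneg x]

theorem norm_spaceTime_fst_le (p : SpaceTime) : ‖p.fst‖ ≤ ‖p‖ := by
  refine le_of_sq_le_sq ?_ (norm_nonneg _)
  rw [WithLp.prod_norm_sq_eq_of_L2]
  exact le_add_of_nonneg_right (sq_nonneg _)

theorem abs_spaceTime_snd_le (p : SpaceTime) : |p.snd| ≤ ‖p‖ := by
  refine le_of_sq_le_sq ?_ (norm_nonneg _)
  rw [WithLp.prod_norm_sq_eq_of_L2]
  exact le_add_of_nonneg_left (sq_nonneg _)

theorem japR_modulation_rpow_le {b : ℝ} (hb : b ≤ 3 / 2) (p : SpaceTime) :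
    japR (p.snd - ‖p.fst‖ ^ 2) ^ (2 * b) ≤ 32 * (1 + ‖p‖ ^ 6) := by
  have h0 := norm_nonneg p
  calc japR (p.snd - ‖p.fst‖ ^ 2) ^ (2 * b) ≤ japR (p.snd - ‖p.fst‖ ^ 2) ^ (3 : ℝ) :=
        Real.rpow_le_rpow_of_exponent_le (one_le_japR _) (by linarith)
    _ = japR (p.snd - ‖p.fst‖ ^ 2) ^ 3 := by norm_cast
    _ ≤ ((1 + ‖p‖) ^ 2) ^ 3 := by
        have hp : 0 ≤ japR (p.snd - ‖p.fst‖ ^ 2) := (japR_pos _).le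
        gcongr
        refine (japR_le_one_add_abs _).trans ?_
        have h1 := abs_sub p.snd (‖p.fst‖ ^ 2)
        rw [abs_of_nonneg (sq_nonneg ‖p.fst‖)] at h1
        have h2 := abs_spaceTime_snd_le p
        have h3 := norm_spaceTime_fst_le p
        have h4 : ‖p.fst‖ ^ 2 ≤ ‖p‖ ^ 2 := by gcongr
        nlinarith
    _ = (1 + ‖p‖) ^ 6 := by ring
    _ ≤ 2 ^ (6 - 1) * (1 ^ 6 + ‖p‖ ^ 6) := add_pow_le zero_le_one h0 6
    _ = _ := by norm_num

theorem integrable_modulation_mul_sq {b : ℝ} (hb : b ≤ 3 / 2) (F : 𝓢(SpaceTime, E)) :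
    Integrable fun p : SpaceTime => japR (p.snd - ‖p.fst‖ ^ 2) ^ (2 * b) * ‖F p‖ ^ 2 := by
  obtain ⟨C, hC⟩ : ∃ C, ∀ p, ‖F p‖ ≤ C := by
    obtain ⟨C, hC⟩ := F.decay 0 0
    exact ⟨C, fun p => by simpa using hC.2 p⟩
  have hF := F.continuous
  have h1 : Integrable fun p : SpaceTime => 32 * C * (‖F p‖ + ‖p‖ ^ 6 * ‖F p‖) :=
    (F.integrable.norm.add (F.integrable_pow_mul volume 6)).const_mul _
  refine h1.mono' (Continuous.aestronglyMeasurable ?_) (.of_forall fun p => ?_)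
  · refine Continuous.mul (Continuous.rpow_const (by fun_prop) fun p => ?_) (by fun_prop)
    exact Or.inl (japR_pos _).ne'
  · have h2 := japR_modulation_rpow_le hb p
    have h3 : 0 ≤ japR (p.snd - ‖p.fst‖ ^ 2) ^ (2 * b) := Real.rpow_nonneg (japR_pos _).le _
    rw [Real.norm_of_nonneg (by positivity)]
    calc japR (p.snd - ‖p.fst‖ ^ 2) ^ (2 * b) * ‖F p‖ ^ 2
        ≤ (32 * (1 + ‖p‖ ^ 6)) * (C * ‖F p‖) := by
          rw [sq ‖F p‖]
          gcongr
          exact hC p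
      _ = _ := by ring

theorem ofReal_XNorm_sq {b : ℝ} (hb : b ≤ 3 / 2) (f : 𝓢(SpaceTime, E)) :
    ENNReal.ofReal (XNorm 3 0 b fun x t => f (stPt x t)) ^ 2 =
      ∫⁻ p : SpaceTime, (ENNReal.ofReal (japR (p.snd - ‖p.fst‖ ^ 2) ^ b) * ‖𝓕 f p‖ₑ) ^ 2 := by
  have hint := integrable_modulation_mul_sq hb (𝓕 f)
  have h0 : ∀ p : SpaceTime, 0 ≤ japR (p.snd - ‖p.fst‖ ^ 2) := fun p => (japR_pos _).le
  have h1 : XNorm 3 0 b (fun x t => f (stPt x t)) =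
      √(∫ p : SpaceTime, japR (p.snd - ‖p.fst‖ ^ 2) ^ (2 * b) * ‖𝓕 f p‖ ^ 2) := by
    rw [integral_spaceTime hint, Real.sqrt_eq_rpow, XNorm]
    simp [stFourier_eq]
  rw [h1, ← ENNReal.ofReal_pow (Real.sqrt_nonneg _), Real.sq_sqrt
    (integral_nonneg fun p => mul_nonneg (Real.rpow_nonneg (h0 p) _) (sq_nonneg _)),
    ofReal_integral_eq_lintegral_ofReal hint
      (.of_forall fun p => mul_nonneg (Real.rpow_nonneg (h0 p) _) (sq_nonneg _))]
  refine lintegral_congr fun p => ?_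
  rw [mul_pow, ENNReal.ofReal_mul (Real.rpow_nonneg (h0 p) _),
    ENNReal.ofReal_pow (norm_nonneg _), ofReal_norm,
    ← ENNReal.ofReal_pow (Real.rpow_nonneg (h0 p) _), ← Real.rpow_natCast (_ ^ b),
    ← Real.rpow_mul (h0 p)]
  congr 3
  push_cast; ring

theorem XNorm_nonneg (b : ℝ) (ψ : Rn 3 → ℝ → E) : 0 ≤ XNorm 3 0 b ψ := by
  refine Real.rpow_nonneg (integral_nonneg fun ξ => integral_nonneg fun τ => ?_) _
  have h1 := jap_pos ξ
  have h2 := japR_pos (τ - ‖ξ‖ ^ 2)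
  positivity

end XNormSection

section Multiplier

/-- A cut-off version of `(1 - z) ^ r`. -/
def cutoffPow (r z : ℝ) : ℝ :=
  (⟨1 / 5, 1 / 2, by norm_num, by norm_num⟩ : ContDiffBump (0 : ℝ)) z * (1 - z) ^ r

theorem cutoffPow_of_abs_le {r z : ℝ} (hz : |z| ≤ 1 / 5) : cutoffPow r z = (1 - z) ^ r := by
  rw [cutoffPow, ContDiffBump.one_of_mem_closedBall _ (by simpa using hz), one_mul]

theorem cutoffPow_of_le_abs {r z : ℝ} (hz : 1 / 2 ≤ |z|) : cutoffPow r z = 0 := by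
  rw [cutoffPow, ContDiffBump.zero_of_le_dist _ (by simpa using hz), zero_mul]

theorem hasTemperateGrowth_cutoffPow (r : ℝ) : Function.HasTemperateGrowth (cutoffPow r) := by
  refine HasCompactSupport.hasTemperateGrowth
    (HasCompactSupport.intro (isCompact_closedBall 0 (1 / 2)) fun z hz => ?_) ?_
  · refine cutoffPow_of_le_abs (le_of_lt ?_)
    simpa using hz
  · rw [contDiff_iff_contDiffAt]
    intro z
    rcases lt_or_ge z 1 with hz | hz
    · refine (ContDiffBump.contDiff _).contDiffAt.mul ?_
      exact (contDiffAt_const.sub contDiffAt_id).rpow_const_of_ne (by simp; linarith)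
    · have h : cutoffPow r =ᶠ[nhds z] fun _ => 0 := by
        filter_upwards [lt_mem_nhds (show (1 / 2 : ℝ) < z by linarith)] with y hy
        exact cutoffPow_of_le_abs (hy.le.trans (le_abs_self y))
      exact contDiffAt_const.congr_of_eventuallyEq h

theorem IsAdmissibleMultiplier.hasTemperateGrowth {n : ℕ} {s : ℝ} {m₁ : Rn n → ℝ}
    (hm : IsAdmissibleMultiplier n s m₁) : Function.HasTemperateGrowth m₁ := by
  obtain ⟨hsm, -, -, -, -, hbig⟩ := hm
  set r : ℝ := -(1 - s)
  set w : Rn n → ℝ := fun ξ =>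
    (1 + ‖ξ‖ ^ 2) ^ (r / 2) * cutoffPow (r / 2) ((1 + ‖ξ‖ ^ 2) ^ (-1 : ℝ)) with hw
  have hwt : Function.HasTemperateGrowth w :=
    (Function.hasTemperateGrowth_one_add_norm_sq_rpow (Rn n) (r / 2)).mul
      ((hasTemperateGrowth_cutoffPow (r / 2)).comp
        (Function.hasTemperateGrowth_one_add_norm_sq_rpow (Rn n) (-1)))
  have hdiff : Function.HasTemperateGrowth (m₁ - w) := by
    refine HasCompactSupport.hasTemperateGrowth
      (HasCompactSupport.intro (isCompact_closedBall 0 3) fun ξ hξ => ?_) (hsm.sub hwt.1)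
    have h3 : 3 < ‖ξ‖ := by simpa using hξ
    have h1 : (0 : ℝ) < 1 + ‖ξ‖ ^ 2 := by positivity
    have h10 : 10 ≤ 1 + ‖ξ‖ ^ 2 := by nlinarith
    have h5 : (1 + ‖ξ‖ ^ 2)⁻¹ ≤ 1 / 5 := by
      rw [inv_le_comm₀ h1 (by norm_num)]
      linarith
    rw [Pi.sub_apply, hbig ξ (by linarith), sub_eq_zero, hw]
    simp only [Real.rpow_neg_one]
    rw [cutoffPow_of_abs_le (by rw [abs_of_pos (by positivity)]; exact h5),
      ← Real.mul_rpow h1.le (by linarith)]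
    have h6 : (1 + ‖ξ‖ ^ 2) * (1 - (1 + ‖ξ‖ ^ 2)⁻¹) = ‖ξ‖ ^ 2 := by
      field_simp; ring
    rw [h6, ← Real.rpow_natCast, ← Real.rpow_mul (norm_nonneg _)]
    congr 1
    push_cast; ring
  simpa using hdiff.add hwt

end Multiplier

section IopSpaceTime
open scoped SchwartzMap

/-- The operator `I_N` acting in the spatial variable of a space-time Schwartz function. -/
def iopSpaceTime (m₁ : Rn 3 → ℝ) (N : ℝ) (φ : 𝓢(SpaceTime, ℂ)) : 𝓢(SpaceTime, ℂ) :=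
  SchwartzMap.fourierMultiplierCLM ℂ (fun p : SpaceTime => (mN m₁ N p.fst : ℂ)) φ

variable {s : ℝ} {m₁ : Rn 3 → ℝ}

theorem IsAdmissibleMultiplier.hasTemperateGrowth_mN (hm : IsAdmissibleMultiplier 3 s m₁)
    (N : ℝ) : Function.HasTemperateGrowth fun p : SpaceTime => (mN m₁ N p.fst : ℂ) :=
  Function.Complex.hasTemperateGrowth_ofReal.comp <| hm.hasTemperateGrowth.comp <|
    ContinuousLinearMap.hasTemperateGrowth (N⁻¹ • (ContinuousLinearMap.fst ℝ (Rn 3) ℝ ∘L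
      (WithLp.prodContinuousLinearEquiv 2 ℝ (Rn 3) ℝ).toContinuousLinearMap))

theorem fourier_iopSpaceTime (hm : IsAdmissibleMultiplier 3 s m₁) (N : ℝ)
    (φ : 𝓢(SpaceTime, ℂ)) (p : SpaceTime) :
    𝓕 (iopSpaceTime m₁ N φ) p = mN m₁ N p.fst * 𝓕 φ p := by
  rw [iopSpaceTime, SchwartzMap.fourierMultiplierCLM_apply, FourierTransform.fourier_fourierInv_eq,
    SchwartzMap.smulLeftCLM_apply_apply (hm.hasTemperateGrowth_mN N), smul_eq_mul]

theorem fourier_spaceSlice_iopSpaceTime (hm : IsAdmissibleMultiplier 3 s m₁) (N : ℝ)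
    (φ : 𝓢(SpaceTime, ℂ)) (t : ℝ) (ξ : Rn 3) :
    𝓕 ⇑(spaceSlice (iopSpaceTime m₁ N φ) t) ξ = mN m₁ N ξ * 𝓕 ⇑(spaceSlice φ t) ξ := by
  rw [fourier_spaceSlice, fourier_spaceSlice, Real.fourierInv_eq', Real.fourierInv_eq',
    ← integral_const_mul]
  refine integral_congr_ae (.of_forall fun τ => ?_)
  simp only [fourier_iopSpaceTime hm, smul_eq_mul]
  exact mul_left_comm _ _ _

theorem iopSpaceTime_stPt (hm : IsAdmissibleMultiplier 3 s m₁) (N : ℝ)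
    (φ : 𝓢(SpaceTime, ℂ)) (x : Rn 3) (t : ℝ) :
    iopSpaceTime m₁ N φ (stPt x t) = Iop m₁ N (fun y => φ (stPt y t)) x := by
  have h : 𝓕⁻ (𝓕 ⇑(spaceSlice (iopSpaceTime m₁ N φ) t)) x = iopSpaceTime m₁ N φ (stPt x t) := by
    rw [← SchwartzMap.fourier_coe, ← SchwartzMap.fourierInv_coe,
      FourierTransform.fourierInv_fourier_eq]
    rfl
  rw [← h, Iop, funext (fourier_spaceSlice_iopSpaceTime hm N φ t)]
  rfl

end IopSpaceTime

section GagliardoNirenbergSobolev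

open Filter Topology ENNReal

lemma exists_eLpNorm_six_le :
    ∃ C : NNReal, ∀ f : Rn 3 → ℂ, ContDiff ℝ 1 f → MemLp f 2 volume →
      eLpNorm f 6 volume ≤ C * eLpNorm (fderiv ℝ f) 2 volume := by
  refine ⟨SNormLESNormFDerivOfEqConst ℂ (volume : Measure (Rn 3)) 2, fun f hf hf2 => ?_⟩
  set K := SNormLESNormFDerivOfEqConst ℂ (volume : Measure (Rn 3)) 2
  let χ : ContDiffBump (0 : Rn 3) := ⟨1, 2, one_pos, one_lt_two⟩
  have hχ : ContDiff ℝ 1 (χ : Rn 3 → ℝ) := χ.contDiff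
  obtain ⟨M, hM⟩ := (χ.hasCompactSupport.fderiv (𝕜 := ℝ)).exists_bound_of_continuous
    (hχ.continuous_fderiv one_ne_zero)
  have hM0 : 0 ≤ M := (norm_nonneg _).trans (hM 0)
  let c : ℕ → ℝ := fun n => ((n : ℝ) + 1)⁻¹
  have hc0 : ∀ n, 0 < c n := fun n => by positivity
  have hc : Tendsto c atTop (𝓝 0) := by
    simpa [c, one_div] using tendsto_one_div_add_atTop_nhds_zero_nat (𝕜 := ℝ)
  let u : ℕ → Rn 3 → ℂ := fun n x => χ (c n • x) • f x
  have hχc : ∀ n, ContDiff ℝ 1 (fun x : Rn 3 => χ (c n • x)) := fun n =>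
    hχ.comp (contDiff_const_smul (c n))
  have hu : ∀ n, ContDiff ℝ 1 (u n) := fun n => (hχc n).smul hf
  have husupp : ∀ n, HasCompactSupport (u n) := fun n =>
    (χ.hasCompactSupport.comp_smul (hc0 n).ne').smul_right
  have hder : ∀ n x, ‖fderiv ℝ (u n) x‖ ≤ ‖fderiv ℝ f x‖ + c n * M * ‖f x‖ := by
    intro n x
    have h1 : HasFDerivAt (fun x : Rn 3 => χ (c n • x))
        ((fderiv ℝ χ (c n • x)).comp (c n • ContinuousLinearMap.id ℝ (Rn 3))) x :=
      HasFDerivAt.comp (g := (χ : Rn 3 → ℝ)) x ((hχ.differentiable one_ne_zero) _).hasFDerivAt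
        ((hasFDerivAt_id x).const_smul (c n))
    have h2 := h1.smul ((hf.differentiable one_ne_zero) x).hasFDerivAt
    rw [show fderiv ℝ (u n) x = _ from h2.fderiv]
    refine (norm_add_le _ _).trans (add_le_add ?_ ?_)
    · rw [norm_smul, Real.norm_eq_abs, abs_of_nonneg χ.nonneg]
      exact mul_le_of_le_one_left (norm_nonneg _) χ.le_one
    · rw [ContinuousLinearMap.norm_smulRight_apply]
      gcongr
      refine (ContinuousLinearMap.opNorm_comp_le _ _).trans ?_
      rw [norm_smul, Real.norm_eq_abs, abs_of_pos (hc0 n), mul_comm]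
      have := ContinuousLinearMap.norm_id_le (𝕜 := ℝ) (E := Rn 3)
      have h3 := hc0 n
      calc c n * ‖ContinuousLinearMap.id ℝ (Rn 3)‖ * ‖fderiv ℝ χ (c n • x)‖
          ≤ c n * 1 * M := by gcongr; exact hM _
        _ = c n * M := by ring
  have hfd : Continuous (fderiv ℝ f) := hf.continuous_fderiv one_ne_zero
  have hbound : ∀ n, eLpNorm (u n) 6 volume ≤
      K * (eLpNorm (fderiv ℝ f) 2 volume + ENNReal.ofReal (c n * M) * eLpNorm f 2 volume) := by
    intro n
    have h1 := eLpNorm_le_eLpNorm_fderiv_of_eq (F := ℂ) (volume : Measure (Rn 3)) (hu n) (husupp n)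
      (p := 2) (p' := 6) (by norm_num) (by simp) (by simp; norm_num)
    refine le_trans (by exact_mod_cast h1) ?_
    gcongr
    calc eLpNorm (fderiv ℝ (u n)) 2 volume
        ≤ eLpNorm ((fun x => ‖fderiv ℝ f x‖) + fun x => c n * M * ‖f x‖) 2 volume := by
          refine eLpNorm_mono_real fun x => ?_
          exact hder n x
      _ ≤ eLpNorm (fun x => ‖fderiv ℝ f x‖) 2 volume
            + eLpNorm (fun x => c n * M * ‖f x‖) 2 volume :=
          eLpNorm_add_le hfd.norm.aestronglyMeasurable
            (hf.continuous.norm.const_mul _ |>.aestronglyMeasurable) (by norm_num)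
      _ = _ := by
          rw [eLpNorm_norm]
          congr 1
          rw [show (fun x => c n * M * ‖f x‖) = (c n * M) • fun x => ‖f x‖ from rfl,
            eLpNorm_const_smul, eLpNorm_norm, Real.enorm_of_nonneg (mul_nonneg (hc0 n).le hM0)]
  have hlim : ∀ᵐ x : Rn 3 ∂volume, Tendsto (fun n => u n x) atTop (𝓝 (f x)) := by
    refine ae_of_all _ fun x => tendsto_const_nhds.congr' ?_
    have hx : Tendsto (fun n => c n • x) atTop (𝓝 0) := by simpa using hc.smul_const x
    filter_upwards [hx.eventually χ.eventuallyEq_one] with n hn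
    simp [u, hn]
  refine (Lp.eLpNorm_lim_le_liminf_eLpNorm (fun n => (hu n).continuous.aestronglyMeasurable)
    f hlim).trans ?_
  refine (liminf_le_liminf (Eventually.of_forall hbound)).trans (le_of_eq ?_)
  refine Tendsto.liminf_eq ?_
  have h0 : Tendsto (fun n => ENNReal.ofReal (c n * M) * eLpNorm f 2 volume) atTop (𝓝 0) := by
    have h1 : Tendsto (fun n => ENNReal.ofReal (c n * M)) atTop (𝓝 0) := by
      simpa using ENNReal.tendsto_ofReal (hc.mul_const M)
    simpa using ENNReal.Tendsto.mul_const h1 (Or.inr hf2.2.ne)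
  have h1 := ENNReal.Tendsto.const_mul (a := (K : ENNReal))
    (tendsto_const_nhds (x := eLpNorm (fderiv ℝ f) 2 volume).add h0) (Or.inr coe_ne_top)
  simpa using h1

lemma exists_lintegral_pow_six_le :
    ∃ C : ENNReal, C < ⊤ ∧ ∀ f : SchwartzMap (Rn 3) ℂ,
      ∫⁻ x, ‖f x‖ₑ ^ 6 ≤ C * (∫⁻ x, ‖fderiv ℝ f x‖ₑ ^ 2) ^ 3 := by
  obtain ⟨K, hK⟩ := exists_eLpNorm_six_le
  refine ⟨K ^ 6, ENNReal.pow_lt_top coe_lt_top, fun f => ?_⟩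
  have h := hK f (f.smooth 1) (f.memLp 2 volume)
  have h6 := eLpNorm_nnreal_pow_eq_lintegral (f := f) (μ := volume) (p := 6) (by norm_num)
  have h2 := eLpNorm_nnreal_pow_eq_lintegral (f := fderiv ℝ f) (μ := volume) (p := 2) (by norm_num)
  simp only [NNReal.coe_ofNat, ENNReal.coe_ofNat, ENNReal.rpow_ofNat] at h6 h2
  rw [← h6, ← h2]
  calc eLpNorm (⇑f) 6 volume ^ 6 ≤ (K * eLpNorm (fderiv ℝ f) 2 volume) ^ 6 := by gcongr
    _ = _ := by ring

end GagliardoNirenbergSobolev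

section LowFrequency
open scoped SchwartzMap

variable {E : Type*} [NormedAddCommGroup E]

/-- The square of the `X_{0,b}` norm, as an extended nonnegative real. -/
def xEnergy [NormedSpace ℂ E] (b : ℝ) (ψ : 𝓢(SpaceTime, E)) : ENNReal :=
  ∫⁻ p : SpaceTime, (ENNReal.ofReal (japR (p.snd - ‖p.fst‖ ^ 2) ^ b) * ‖𝓕 ψ p‖ₑ) ^ 2

variable [InnerProductSpace ℂ E] [CompleteSpace E]

theorem lintegral_enorm_schwartz_fourier_sq (f : 𝓢(Rn 3, E)) :
    ∫⁻ ξ, ‖𝓕 ⇑f ξ‖ₑ ^ 2 = ∫⁻ x, ‖f x‖ₑ ^ 2 := by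
  have key : ∀ g : 𝓢(Rn 3, E), ∫⁻ x, ‖g x‖ₑ ^ 2 = ENNReal.ofReal (∫ x, ‖g x‖ ^ 2) := fun g => by
    have hg : Integrable fun x => ‖g x‖ ^ 2 :=
      (memLp_two_iff_integrable_sq_norm g.continuous.aestronglyMeasurable).1 (g.memLp 2 volume)
    rw [ofReal_integral_eq_lintegral_ofReal hg (.of_forall fun x => sq_nonneg _)]
    simp_rw [ENNReal.ofReal_pow (norm_nonneg _), ofReal_norm]
  rw [key, ← SchwartzMap.integral_norm_sq_fourier, ← key, SchwartzMap.fourier_coe]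

theorem lintegral_spaceSlice_sq_le (b : ℝ) (ψ : 𝓢(SpaceTime, E)) (t : ℝ) :
    ∫⁻ x, ‖ψ (stPt x t)‖ₑ ^ 2 ≤
      (∫⁻ τ, ENNReal.ofReal (japR τ ^ (-(2 * b)))) * xEnergy b ψ := by
  set B := ∫⁻ τ, ENNReal.ofReal (japR τ ^ (-(2 * b))) with hB
  set W : Rn 3 → ℝ → ENNReal := fun ξ τ =>
    (ENNReal.ofReal (japR (τ - ‖ξ‖ ^ 2) ^ b) * ‖𝓕 ψ (stPt ξ τ)‖ₑ) ^ 2 with hW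
  have hψm : Measurable fun p : SpaceTime =>
      (ENNReal.ofReal (japR (p.snd - ‖p.fst‖ ^ 2) ^ b) * ‖𝓕 ψ p‖ₑ) ^ 2 := by
    have h2 : Measurable fun p => ‖𝓕 ψ p‖ₑ := (𝓕 ψ).continuous.enorm.measurable
    fun_prop
  have hWm : Measurable (Function.uncurry W) :=
    hψm.comp (WithLp.volume_preserving_toLp (Rn 3) ℝ).measurable
  have hslice : ∀ ξ, ‖𝓕 ⇑(spaceSlice ψ t) ξ‖ₑ ^ 2 ≤ B * ∫⁻ τ, W ξ τ := fun ξ => by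
    have hJ : Measurable japR := continuous_japR.measurable
    have hF : Measurable fun τ => ‖𝓕 ψ (stPt ξ τ)‖ₑ :=
      (timeSlice (𝓕 ψ) ξ).continuous.enorm.measurable
    calc ‖𝓕 ⇑(spaceSlice ψ t) ξ‖ₑ ^ 2
        ≤ (∫⁻ τ, ENNReal.ofReal (japR (τ - ‖ξ‖ ^ 2) ^ (-b)) *
            (ENNReal.ofReal (japR (τ - ‖ξ‖ ^ 2) ^ b) * ‖𝓕 ψ (stPt ξ τ)‖ₑ)) ^ 2 := by
          rw [fourier_spaceSlice, Real.fourierInv_eq']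
          gcongr
          refine (enorm_integral_le_lintegral_enorm _).trans (lintegral_mono fun τ => le_of_eq ?_)
          have h := japR_pos (τ - ‖ξ‖ ^ 2)
          rw [← mul_assoc, ← ENNReal.ofReal_mul (by positivity), ← Real.rpow_add h, neg_add_cancel,
            Real.rpow_zero, ENNReal.ofReal_one, one_mul, ← ofReal_norm, ← ofReal_norm,
            norm_cexp_ofReal_mul_I_smul]
      _ ≤ (∫⁻ τ, ENNReal.ofReal (japR (τ - ‖ξ‖ ^ 2) ^ (-b)) ^ 2) * ∫⁻ τ, W ξ τ :=
          sq_lintegral_mul_le _ (by fun_prop) (by fun_prop)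
      _ = B * ∫⁻ τ, W ξ τ := by
          rw [hB, ← lintegral_sub_right_eq_self (fun τ => ENNReal.ofReal (japR τ ^ (-(2 * b))))
            (‖ξ‖ ^ 2)]
          congr 1
          refine lintegral_congr fun τ => ?_
          have h := japR_pos (τ - ‖ξ‖ ^ 2)
          rw [← ENNReal.ofReal_pow (by positivity), ← Real.rpow_natCast, ← Real.rpow_mul h.le]
          congr 2
          push_cast; ring
  calc ∫⁻ x, ‖ψ (stPt x t)‖ₑ ^ 2 = ∫⁻ ξ, ‖𝓕 ⇑(spaceSlice ψ t) ξ‖ₑ ^ 2 :=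
        (lintegral_enorm_schwartz_fourier_sq (spaceSlice ψ t)).symm
    _ ≤ ∫⁻ ξ, B * ∫⁻ τ, W ξ τ := lintegral_mono hslice
    _ = B * xEnergy b ψ := by
        have hWm' : Measurable fun ξ => ∫⁻ τ, W ξ τ := hWm.lintegral_prod_right'
        rw [lintegral_const_mul _ hWm', ← lintegral_spaceTime W hWm]
        rfl

theorem norm_fderiv_le_norm_gradC {n : ℕ} (f : Rn n → ℂ) (x : Rn n) :
    ‖fderiv ℝ f x‖ ≤ ‖gradC f x‖ := by
  refine ContinuousLinearMap.opNorm_le_bound _ (norm_nonneg _) fun v => ?_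
  have hv : v = ∑ i, v i • EuclideanSpace.single i (1 : ℝ) := by
    simpa using ((EuclideanSpace.basisFun (Fin n) ℝ).sum_repr v).symm
  calc ‖fderiv ℝ f x v‖ = ‖∑ i, v i • gradC f x i‖ := by
        conv_lhs => rw [hv]
        simp [gradC]
    _ ≤ ∑ i, ‖gradC f x i‖ * ‖v i‖ :=
        (norm_sum_le _ _).trans_eq (Finset.sum_congr rfl fun i _ => by rw [norm_smul, mul_comm])
    _ ≤ ‖gradC f x‖ * ‖v‖ := by
        rw [EuclideanSpace.norm_eq, EuclideanSpace.norm_eq]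
        exact Real.sum_mul_le_sqrt_mul_sqrt _ _ _

theorem exists_lintegral_slice_pow_six_le {b : ℝ} (hb : 1 / 2 < b) :
    ∃ K : ENNReal, K < ⊤ ∧ ∀ (θ : 𝓢(SpaceTime, ℂ)) (ψ : 𝓢(SpaceTime, EuclideanSpace ℂ (Fin 3)))
      (t : ℝ), (∀ x, ψ (stPt x t) = gradC (fun y => θ (stPt y t)) x) →
      ∫⁻ x, ‖θ (stPt x t)‖ₑ ^ 6 ≤ K * xEnergy b ψ ^ 3 := by
  obtain ⟨C, hC, hGNS⟩ := exists_lintegral_pow_six_le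
  set B := ∫⁻ τ, ENNReal.ofReal (japR τ ^ (-(2 * b))) with hB
  refine ⟨C * B ^ 3, ENNReal.mul_lt_top hC
    (ENNReal.pow_lt_top (lintegral_japR_rpow_lt_top hb)), fun θ ψ t h => ?_⟩
  calc ∫⁻ x, ‖θ (stPt x t)‖ₑ ^ 6 ≤ C * (∫⁻ x, ‖fderiv ℝ (spaceSlice θ t) x‖ₑ ^ 2) ^ 3 :=
        hGNS (spaceSlice θ t)
    _ ≤ C * (∫⁻ x, ‖ψ (stPt x t)‖ₑ ^ 2) ^ 3 := by
        gcongr with x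
        rw [h x, ← ofReal_norm, ← ofReal_norm]
        exact ENNReal.ofReal_le_ofReal (norm_fderiv_le_norm_gradC _ x)
    _ ≤ C * (B * xEnergy b ψ) ^ 3 := by
        gcongr
        exact lintegral_spaceSlice_sq_le b ψ t
    _ = _ := by ring

end LowFrequency

section HighFrequency
open scoped SchwartzMap LineDeriv

/-- The complex-bilinear pairing of a real vector with a complex vector. -/
def realPairing (ξ : Rn 3) : EuclideanSpace ℂ (Fin 3) →L[ℂ] ℂ :=
  ∑ j, (ξ j : ℂ) • (EuclideanSpace.proj j : EuclideanSpace ℂ (Fin 3) →L[ℂ] ℂ)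

theorem realPairing_apply (ξ : Rn 3) (v : EuclideanSpace ℂ (Fin 3)) :
    realPairing ξ v = ∑ j, (ξ j : ℂ) * v j := by
  simp [realPairing]

theorem norm_realPairing_le (ξ : Rn 3) (v : EuclideanSpace ℂ (Fin 3)) :
    ‖realPairing ξ v‖ ≤ ‖ξ‖ * ‖v‖ := by
  rw [realPairing_apply, EuclideanSpace.norm_eq, EuclideanSpace.norm_eq]
  refine (norm_sum_le _ _).trans (le_trans (le_of_eq ?_) (Real.sum_mul_le_sqrt_mul_sqrt _ _ _))
  simp

theorem realPairing_gradC (ξ : Rn 3) (f : Rn 3 → ℂ) (x : Rn 3) :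
    realPairing ξ (gradC f x) = fderiv ℝ f x ξ := by
  have hv : ξ = ∑ i, ξ i • EuclideanSpace.single i (1 : ℝ) := by
    simpa using ((EuclideanSpace.basisFun (Fin 3) ℝ).sum_repr ξ).symm
  conv_rhs => rw [hv]
  simp [realPairing_apply, gradC]

theorem realPairing_fourier_gradC (θ : 𝓢(Rn 3, ℂ)) (ψ : 𝓢(Rn 3, EuclideanSpace ℂ (Fin 3)))
    (h : ∀ x, ψ x = gradC θ x) (ξ : Rn 3) :
    realPairing ξ (𝓕 ⇑ψ ξ) = 2 * Real.pi * I * ‖ξ‖ ^ 2 * 𝓕 ⇑θ ξ := by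
  have h1 : realPairing ξ (𝓕 ⇑ψ ξ) = 𝓕 ⇑(∂_{ξ} θ : 𝓢(Rn 3, ℂ)) ξ := by
    rw [Real.fourier_eq', Real.fourier_eq', ← ContinuousLinearMap.integral_comp_comm]
    · refine integral_congr_ae (.of_forall fun x => ?_)
      simp only [map_smul]
      rw [h, realPairing_gradC, SchwartzMap.lineDerivOp_apply_eq_fderiv]
    · have := ψ.continuous
      refine ψ.integrable.mono (Continuous.aestronglyMeasurable (by fun_prop))
        (.of_forall fun q => ?_)
      rw [norm_cexp_ofReal_mul_I_smul]
  have h2 : (inner ℝ · ξ).HasTemperateGrowth := ((innerSL ℝ).flip ξ).hasTemperateGrowth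
  rw [h1, ← SchwartzMap.fourier_coe, SchwartzMap.fourier_lineDerivOp_eq, smul_apply,
    SchwartzMap.smulLeftCLM_apply_apply h2, real_inner_self_eq_norm_sq, SchwartzMap.fourier_coe]
  simp
  ring

variable {s : ℝ} {m₁ : Rn 3 → ℝ}

theorem IsAdmissibleMultiplier.half_rpow_le (hm : IsAdmissibleMultiplier 3 s m₁) (hs0 : 0 ≤ s)
    (hs : s < 1) {ζ : Rn 3} (hζ : 1 ≤ ‖ζ‖) : ‖ζ‖ ^ (-(1 - s)) / 2 ≤ m₁ ζ := by
  obtain ⟨-, -, -, hanti, -, hpow⟩ := hm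
  have hz : 0 < ‖ζ‖ := by linarith
  rcases le_total 2 ‖ζ‖ with h | h
  · rw [hpow ζ h]
    exact half_le_self (by positivity)
  · have h2 : ‖(EuclideanSpace.single 0 2 : Rn 3)‖ = 2 := by simp
    have h3 := hanti ζ (EuclideanSpace.single 0 2) (by rw [h2]; exact h)
    rw [hpow _ h2.ge, h2] at h3
    refine le_trans ?_ h3
    have h4 : ‖ζ‖ ^ (-(1 - s)) ≤ 1 := Real.rpow_le_one_of_one_le_of_nonpos hζ (by linarith)
    have h5 : (2 : ℝ) ^ (-1 : ℝ) ≤ 2 ^ (-(1 - s)) :=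
      Real.rpow_le_rpow_of_exponent_le one_le_two (by linarith)
    rw [Real.rpow_neg_one] at h5
    linarith

/-- The multiplier recovering the high-frequency part of `f` from the divergence of
`∇ I_N f`, up to the factor `(2πi)⁻¹`. -/
def highMult (m₁ : Rn 3 → ℝ) (N : ℝ) (ξ : Rn 3) : ℝ := (1 - mN m₁ N ξ) / (‖ξ‖ ^ 2 * mN m₁ N ξ)

theorem IsAdmissibleMultiplier.highMult_nonneg (hm : IsAdmissibleMultiplier 3 s m₁) (N : ℝ)
    (ξ : Rn 3) : 0 ≤ highMult m₁ N ξ := by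
  have h := hm.2.1 (N⁻¹ • ξ)
  exact div_nonneg (sub_nonneg.2 h.2) (mul_nonneg (sq_nonneg _) h.1.le)

theorem IsAdmissibleMultiplier.highMult_mul_le (hm : IsAdmissibleMultiplier 3 s m₁)
    (hs0 : 0 ≤ s) (hs : s < 1) {N : ℝ} (hN : 1 ≤ N) (ξ : Rn 3) :
    highMult m₁ N ξ * ‖ξ‖ ≤ 4 * jap ξ ^ (-s) := by
  have hN0 : 0 < N := by linarith
  have hj := jap_pos ξ
  have hζ : ‖N⁻¹ • ξ‖ = ‖ξ‖ / N := by
    rw [norm_smul, Real.norm_of_nonneg (by positivity)]; ring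
  rcases le_total ‖ξ‖ N with h | h
  · have : mN m₁ N ξ = 1 := hm.2.2.2.2.1 _ (by rw [hζ]; exact (div_le_one hN0).2 h)
    rw [highMult, this]
    simp only [sub_self, zero_div, zero_mul]
    positivity
  · have hξ1 : 1 ≤ ‖ξ‖ := hN.trans h
    have hξ : 0 < ‖ξ‖ := by linarith
    have h1 : ‖ξ‖ ^ (-(1 - s)) / 2 ≤ mN m₁ N ξ := by
      refine le_trans ?_ (hm.half_rpow_le hs0 hs (by rw [hζ]; exact (one_le_div hN0).2 h))
      gcongr ?_ / 2
      rw [hζ]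
      exact Real.rpow_le_rpow_of_nonpos (by positivity) (div_le_self hξ.le hN) (by linarith)
    have hm0 : 0 < mN m₁ N ξ := (hm.2.1 _).1
    have h2 : highMult m₁ N ξ * ‖ξ‖ ≤ 1 / (‖ξ‖ * mN m₁ N ξ) := by
      rw [highMult, div_mul_eq_mul_div, div_le_div_iff₀ (by positivity) (by positivity)]
      have : 0 ≤ mN m₁ N ξ * (‖ξ‖ ^ 2 * mN m₁ N ξ) := by positivity
      nlinarith
    have h3 : 1 / (‖ξ‖ * mN m₁ N ξ) ≤ 2 * ‖ξ‖ ^ (-s) := by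
      rw [div_le_iff₀ (by positivity)]
      calc (1 : ℝ) = 2 * ‖ξ‖ ^ (-s) * (‖ξ‖ * (‖ξ‖ ^ (-(1 - s)) / 2)) := by
            have : ‖ξ‖ ^ (-s) * ‖ξ‖ * ‖ξ‖ ^ (-(1 - s)) = 1 := by
              rw [← Real.rpow_add_one hξ.ne', ← Real.rpow_add hξ]
              convert Real.rpow_zero _ using 2; ring
            linarith
        _ ≤ _ := by gcongr
    have h4 : ‖ξ‖ ^ (-s) ≤ 2 * jap ξ ^ (-s) := by
      have h5 : jap ξ / 2 ≤ ‖ξ‖ := by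
        rw [div_le_iff₀ two_pos, jap, Real.sqrt_le_left (by positivity)]
        nlinarith
      calc ‖ξ‖ ^ (-s) ≤ (jap ξ / 2) ^ (-s) :=
            Real.rpow_le_rpow_of_nonpos (by positivity) h5 (by linarith)
        _ = 2 ^ s * jap ξ ^ (-s) := by
            rw [Real.div_rpow hj.le two_pos.le, Real.rpow_neg two_pos.le]
            field_simp
        _ ≤ 2 ^ (1 : ℝ) * jap ξ ^ (-s) := by
            gcongr
            norm_num
        _ = _ := by rw [Real.rpow_one]
    linarith

theorem IsAdmissibleMultiplier.continuous_mN (hm : IsAdmissibleMultiplier 3 s m₁) (N : ℝ) :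
    Continuous (mN m₁ N) := hm.1.continuous.comp (continuous_const_smul _)

theorem IsAdmissibleMultiplier.highMult_mul_sq_mul (hm : IsAdmissibleMultiplier 3 s m₁) (N : ℝ)
    (ξ : Rn 3) : highMult m₁ N ξ * (‖ξ‖ ^ 2 * mN m₁ N ξ) = 1 - mN m₁ N ξ := by
  have hm0 : 0 < mN m₁ N ξ := (hm.2.1 _).1
  rcases eq_or_ne ξ 0 with rfl | h
  · have : mN m₁ N 0 = 1 := hm.2.2.2.2.1 _ (by simp)
    simp [this]
  · have := norm_pos_iff.2 h
    exact div_mul_cancel₀ _ (by positivity)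

/-- The space-time Fourier transform of the high-frequency part of a function, expressed through
an extension `ψ` of `∇ I_N φ`. -/
def highPart (m₁ : Rn 3 → ℝ) (N : ℝ) (ψ : 𝓢(SpaceTime, EuclideanSpace ℂ (Fin 3)))
    (p : SpaceTime) : ℂ :=
  (2 * Real.pi * I)⁻¹ * highMult m₁ N p.fst * realPairing p.fst (𝓕 ψ p)

theorem norm_two_pi_I_inv_le : ‖(2 * Real.pi * I : ℂ)⁻¹‖ ≤ 1 := by
  have := Real.pi_gt_three
  rw [norm_inv]
  refine inv_le_one_of_one_le₀ ?_
  simp only [norm_mul, norm_real, norm_I, RCLike.norm_ofNat, Real.norm_of_nonneg Real.pi_nonneg]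
  linarith

theorem IsAdmissibleMultiplier.norm_highPart_le (hm : IsAdmissibleMultiplier 3 s m₁)
    (hs0 : 0 ≤ s) (hs : s < 1) {N : ℝ} (hN : 1 ≤ N)
    (ψ : 𝓢(SpaceTime, EuclideanSpace ℂ (Fin 3))) (p : SpaceTime) :
    ‖highPart m₁ N ψ p‖ ≤ 4 * jap p.fst ^ (-s) * ‖𝓕 ψ p‖ := by
  have h0 := hm.highMult_nonneg N p.fst
  have h1 := norm_two_pi_I_inv_le
  rw [highPart, norm_mul, norm_mul, norm_real, Real.norm_of_nonneg h0]
  calc _ ≤ 1 * highMult m₁ N p.fst * (‖p.fst‖ * ‖𝓕 ψ p‖) := by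
        gcongr
        exact norm_realPairing_le _ _
    _ = highMult m₁ N p.fst * ‖p.fst‖ * ‖𝓕 ψ p‖ := by ring
    _ ≤ _ := mul_le_mul_of_nonneg_right (hm.highMult_mul_le hs0 hs hN _) (norm_nonneg _)

theorem IsAdmissibleMultiplier.measurable_highPart (hm : IsAdmissibleMultiplier 3 s m₁) (N : ℝ)
    (ψ : 𝓢(SpaceTime, EuclideanSpace ℂ (Fin 3))) : Measurable (highPart m₁ N ψ) := by
  have h1 : Measurable fun p : SpaceTime => p.fst := continuous_spaceTime_fst.measurable
  have h2 : Measurable (mN m₁ N) := (hm.continuous_mN N).measurable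
  have h3 : Measurable fun p : SpaceTime => realPairing p.fst (𝓕 ψ p) := by
    have := (𝓕 ψ).continuous
    simp only [realPairing_apply]
    exact (by fun_prop : Continuous _).measurable
  unfold highPart highMult
  fun_prop

theorem IsAdmissibleMultiplier.integrable_highPart (hm : IsAdmissibleMultiplier 3 s m₁)
    (hs0 : 0 ≤ s) (hs : s < 1) {N : ℝ} (hN : 1 ≤ N)
    (ψ : 𝓢(SpaceTime, EuclideanSpace ℂ (Fin 3))) : Integrable (highPart m₁ N ψ) := by
  refine ((𝓕 ψ).integrable.norm.const_mul 4).mono' (hm.measurable_highPart N ψ).aestronglyMeasurable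
    (.of_forall fun p => (hm.norm_highPart_le hs0 hs hN ψ p).trans ?_)
  have h1 : jap p.fst ^ (-s) ≤ 1 :=
    Real.rpow_le_one_of_one_le_of_nonpos (Real.one_le_sqrt.2 (by simp)) (by linarith)
  have := norm_nonneg (𝓕 ψ p)
  nlinarith

end HighFrequency

section PerFunctionBound
open scoped SchwartzMap

variable {s : ℝ} {m₁ : Rn 3 → ℝ}

theorem IsAdmissibleMultiplier.fourierInv_highPart_slice (hm : IsAdmissibleMultiplier 3 s m₁)
    (N : ℝ) (φ : 𝓢(SpaceTime, ℂ)) (ψ : 𝓢(SpaceTime, EuclideanSpace ℂ (Fin 3))) (t : ℝ)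
    (h : ∀ x, ψ (stPt x t) = gradC (fun y => iopSpaceTime m₁ N φ (stPt y t)) x) (ξ : Rn 3) :
    𝓕⁻ (fun τ => highPart m₁ N ψ (stPt ξ τ)) t =
      𝓕 ⇑(spaceSlice φ t - spaceSlice (iopSpaceTime m₁ N φ) t) ξ := by
  have h1 : 𝓕⁻ (fun τ => highPart m₁ N ψ (stPt ξ τ)) t =
      (2 * Real.pi * I)⁻¹ * highMult m₁ N ξ * realPairing ξ (𝓕 ⇑(spaceSlice ψ t) ξ) := by
    rw [fourier_spaceSlice, Real.fourierInv_eq', Real.fourierInv_eq',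
      ← ContinuousLinearMap.integral_comp_comm, ← integral_const_mul]
    · refine integral_congr_ae (.of_forall fun τ => ?_)
      simp only [highPart, map_smul, smul_eq_mul]
      exact mul_left_comm _ _ _
    · have := (timeSlice (𝓕 ψ) ξ).continuous
      refine (timeSlice (𝓕 ψ) ξ).integrable.mono
        (Continuous.aestronglyMeasurable (by simp only [← timeSlice_apply]; fun_prop))
        (.of_forall fun q => ?_)
      rw [norm_cexp_ofReal_mul_I_smul, timeSlice_apply]
  have h2 := realPairing_fourier_gradC (spaceSlice (iopSpaceTime m₁ N φ) t) (spaceSlice ψ t) h ξ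
  have h3 : 𝓕 ⇑(spaceSlice φ t - spaceSlice (iopSpaceTime m₁ N φ) t) ξ =
      𝓕 ⇑(spaceSlice φ t) ξ - 𝓕 ⇑(spaceSlice (iopSpaceTime m₁ N φ) t) ξ := by
    simp only [← SchwartzMap.fourier_coe]
    exact congrArg (· ξ) (map_sub (FourierTransform.fourierCLM ℂ 𝓢(Rn 3, ℂ)) _ _)
  rw [h1, h2, h3, fourier_spaceSlice_iopSpaceTime hm]
  have h4 : (highMult m₁ N ξ : ℂ) * (‖ξ‖ ^ 2 * mN m₁ N ξ) = 1 - mN m₁ N ξ := by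
    exact_mod_cast hm.highMult_mul_sq_mul N ξ
  have h5 : (2 * Real.pi * I : ℂ)⁻¹ * (2 * Real.pi * I) = 1 := inv_mul_cancel₀ (by simp)
  calc _ = (2 * Real.pi * I : ℂ)⁻¹ * (2 * Real.pi * I) *
        (highMult m₁ N ξ * (‖ξ‖ ^ 2 * mN m₁ N ξ)) * 𝓕 ⇑(spaceSlice φ t) ξ := by ring
    _ = _ := by rw [h4, h5]; ring

theorem IsAdmissibleMultiplier.fourierInv_highPart (hm : IsAdmissibleMultiplier 3 s m₁)
    (hs0 : 0 ≤ s) (hs : s < 1) {N : ℝ} (hN : 1 ≤ N) (φ : 𝓢(SpaceTime, ℂ))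
    (ψ : 𝓢(SpaceTime, EuclideanSpace ℂ (Fin 3))) (t : ℝ)
    (h : ∀ x, ψ (stPt x t) = gradC (fun y => iopSpaceTime m₁ N φ (stPt y t)) x) (x : Rn 3) :
    𝓕⁻ (highPart m₁ N ψ) (stPt x t) = φ (stPt x t) - iopSpaceTime m₁ N φ (stPt x t) := by
  have hint : Integrable (fun p : SpaceTime =>
      cexp (↑(2 * Real.pi * ⟪p, stPt x t⟫) * I) • highPart m₁ N ψ p) := by
    have hc : Continuous fun p : SpaceTime =>
        cexp (↑(2 * Real.pi * ⟪p, stPt x t⟫) * I) := by fun_prop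
    refine (hm.integrable_highPart hs0 hs hN ψ).mono (hc.aestronglyMeasurable.smul
      (hm.measurable_highPart N ψ).aestronglyMeasurable) (.of_forall fun q => ?_)
    rw [norm_cexp_ofReal_mul_I_smul]
  have h1 : 𝓕⁻ (highPart m₁ N ψ) (stPt x t) =
      𝓕⁻ (𝓕 ⇑(spaceSlice φ t - spaceSlice (iopSpaceTime m₁ N φ) t)) x := by
    rw [Real.fourierInv_eq', integral_spaceTime hint, Real.fourierInv_eq']
    refine integral_congr_ae (.of_forall fun ξ => ?_)
    simp only
    rw [← hm.fourierInv_highPart_slice N φ ψ t h ξ, Real.fourierInv_eq', ← integral_smul]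
    refine integral_congr_ae (.of_forall fun τ => ?_)
    simp only [inner_stPt, smul_smul, ← Complex.exp_add]
    congr 2
    simp
    ring
  rw [h1, ← SchwartzMap.fourier_coe, ← SchwartzMap.fourierInv_coe,
    FourierTransform.fourierInv_fourier_eq]
  rfl

theorem exists_lintegral_highPart_pow_six_le {b : ℝ} (hs : 5 / 6 < s) (hs1 : s < 1)
    (hb : 1 / 2 < b) (hm : IsAdmissibleMultiplier 3 s m₁) :
    ∃ K : ENNReal, K < ⊤ ∧ ∀ N, 1 ≤ N → ∀ ψ : 𝓢(SpaceTime, EuclideanSpace ℂ (Fin 3)),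
      ∫⁻ p, ‖𝓕⁻ (highPart m₁ N ψ) p‖ₑ ^ 6 ≤ K * xEnergy b ψ ^ 3 := by
  obtain ⟨K, hK, hKw⟩ := exists_lintegral_xWeight_le hs hb
  refine ⟨K * (4 ^ 2) ^ 3, by finiteness, fun N hN ψ => ?_⟩
  have hs0 : 0 ≤ s := by linarith
  have hF : Measurable fun p => ‖𝓕 ψ p‖ₑ := (𝓕 ψ).continuous.enorm.measurable
  have key := lintegral_enorm_fourierInv_pow_six_le (hm.integrable_highPart hs0 hs1 hN ψ)
    (hm.measurable_highPart N ψ) (measurable_xWeight s b) (h := fun p : SpaceTime =>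
      4 * (ENNReal.ofReal (japR (p.snd - ‖p.fst‖ ^ 2) ^ b) * ‖𝓕 ψ p‖ₑ)) (by fun_prop)
    (fun p => ?_) hKw
  · refine key.trans (le_of_eq ?_)
    simp_rw [mul_pow (4 : ENNReal)]
    rw [lintegral_const_mul _ (by fun_prop), mul_pow, ← mul_assoc, xEnergy]
  · have h := japR_pos (p.snd - ‖p.fst‖ ^ 2)
    have hj := jap_pos p.fst
    have h1 : xWeight s b p * ENNReal.ofReal (japR (p.snd - ‖p.fst‖ ^ 2) ^ b) =
        ENNReal.ofReal (jap p.fst ^ (-s)) := by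
      rw [xWeight, ← ENNReal.ofReal_mul (by positivity), mul_assoc, ← Real.rpow_add h,
        neg_add_cancel, Real.rpow_zero, mul_one]
    calc ‖highPart m₁ N ψ p‖ₑ ≤ ENNReal.ofReal (4 * jap p.fst ^ (-s) * ‖𝓕 ψ p‖) := by
          rw [← ofReal_norm]
          exact ENNReal.ofReal_le_ofReal (hm.norm_highPart_le hs0 hs1 hN ψ p)
      _ = 4 * (ENNReal.ofReal (jap p.fst ^ (-s)) * ‖𝓕 ψ p‖ₑ) := by
          rw [mul_assoc, ENNReal.ofReal_mul (by positivity), ENNReal.ofReal_mul (by positivity),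
            ofReal_norm, ENNReal.ofReal_ofNat]
      _ = _ := by rw [← h1]; ring

theorem IsAdmissibleMultiplier.continuous_fourierInv_highPart
    (hm : IsAdmissibleMultiplier 3 s m₁) (hs0 : 0 ≤ s) (hs : s < 1) {N : ℝ} (hN : 1 ≤ N)
    (ψ : 𝓢(SpaceTime, EuclideanSpace ℂ (Fin 3))) : Continuous (𝓕⁻ (highPart m₁ N ψ)) := by
  rw [show 𝓕⁻ (highPart m₁ N ψ) = fun p => 𝓕 (highPart m₁ N ψ) (-p) from
    funext fun p => Real.fourierInv_eq_fourier_neg _ p]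
  exact (VectorFourier.fourierIntegral_continuous Real.continuous_fourierChar continuous_inner
    (hm.integrable_highPart hs0 hs hN ψ)).comp continuous_neg

theorem enorm_pow_six_le (z w : ℂ) : ‖z‖ₑ ^ 6 ≤ 2 ^ 5 * (‖w‖ₑ ^ 6 + ‖z - w‖ₑ ^ 6) := by
  have h := ENNReal.rpow_add_le_mul_rpow_add_rpow ‖w‖ₑ ‖z - w‖ₑ (p := 6) (by norm_num)
  have h5 : (6 : ℝ) - 1 = (5 : ℕ) := by norm_num
  rw [h5] at h
  simp only [ENNReal.rpow_ofNat, ENNReal.rpow_natCast] at h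
  refine le_trans ?_ h
  gcongr
  calc ‖z‖ₑ = ‖w + (z - w)‖ₑ := by rw [add_sub_cancel]
    _ ≤ _ := enorm_add_le _ _

theorem setLIntegral_lintegral_stPt_le {H : SpaceTime → ENNReal} (hH : Measurable H) (δ : ℝ) :
    ∫⁻ t in Icc 0 δ, ∫⁻ x, H (stPt x t) ≤ ∫⁻ p, H p := by
  have hHm : Measurable (Function.uncurry fun x t => H (stPt x t)) :=
    hH.comp (WithLp.volume_preserving_toLp (Rn 3) ℝ).measurable
  have hHm1 : Measurable (Function.uncurry fun t x => H (stPt x t)) := hHm.comp measurable_swap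
  calc ∫⁻ t in Icc 0 δ, ∫⁻ x, H (stPt x t) ≤ ∫⁻ t, ∫⁻ x, H (stPt x t) :=
        setLIntegral_le_lintegral _ _
    _ = ∫⁻ x, ∫⁻ t, H (stPt x t) := lintegral_lintegral_swap hHm1.aemeasurable
    _ = _ := (lintegral_spaceTime (fun x t => H (stPt x t)) hHm).symm

theorem exists_lintegral_pow_six_le_xEnergy {b : ℝ} (hs : 5 / 6 < s) (hs1 : s < 1)
    (hb : 1 / 2 < b) (hm : IsAdmissibleMultiplier 3 s m₁) :
    ∃ K : ENNReal, K < ⊤ ∧ ∀ N, 1 ≤ N → ∀ δ : ℝ, δ ≤ 1 → ∀ (φ : 𝓢(SpaceTime, ℂ))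
      (ψ : 𝓢(SpaceTime, EuclideanSpace ℂ (Fin 3))),
      (∀ t ∈ Icc 0 δ, ∀ x, ψ (stPt x t) = gradC (Iop m₁ N fun y => φ (stPt y t)) x) →
      ∫⁻ t in Icc 0 δ, ∫⁻ x, ‖φ (stPt x t)‖ₑ ^ 6 ≤ K * xEnergy b ψ ^ 3 := by
  obtain ⟨K₁, hK₁, hlow⟩ := exists_lintegral_slice_pow_six_le hb
  obtain ⟨K₂, hK₂, hhigh⟩ := exists_lintegral_highPart_pow_six_le hs hs1 hb hm
  refine ⟨2 ^ 5 * (K₁ + K₂), by finiteness, fun N hN δ hδ φ ψ h => ?_⟩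
  have hs0 : 0 ≤ s := by linarith
  have h' : ∀ t ∈ Icc 0 δ, ∀ x,
      ψ (stPt x t) = gradC (fun y => iopSpaceTime m₁ N φ (stPt y t)) x := fun t ht x => by
    rw [h t ht x, funext fun y => iopSpaceTime_stPt hm N φ y t]
  let H : SpaceTime → ENNReal := fun p => ‖𝓕⁻ (highPart m₁ N ψ) p‖ₑ ^ 6
  have hHm : Measurable H :=
    (hm.continuous_fourierInv_highPart hs0 hs1 hN ψ).enorm.measurable.pow_const 6
  have hslice : ∀ t ∈ Icc 0 δ, ∫⁻ x, ‖φ (stPt x t)‖ₑ ^ 6 ≤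
      2 ^ 5 * (K₁ * xEnergy b ψ ^ 3 + ∫⁻ x, H (stPt x t)) := fun t ht => by
    have hθ : Measurable fun x => ‖iopSpaceTime m₁ N φ (stPt x t)‖ₑ ^ 6 :=
      (spaceSlice (iopSpaceTime m₁ N φ) t).continuous.enorm.measurable.pow_const 6
    calc ∫⁻ x, ‖φ (stPt x t)‖ₑ ^ 6
        ≤ ∫⁻ x, 2 ^ 5 * (‖iopSpaceTime m₁ N φ (stPt x t)‖ₑ ^ 6 + H (stPt x t)) := by
          refine lintegral_mono fun x => ?_
          simp only [H]
          rw [hm.fourierInv_highPart hs0 hs1 hN φ ψ t (h' t ht) x]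
          exact enorm_pow_six_le _ _
      _ = 2 ^ 5 * ((∫⁻ x, ‖iopSpaceTime m₁ N φ (stPt x t)‖ₑ ^ 6) + ∫⁻ x, H (stPt x t)) := by
          rw [lintegral_const_mul' _ _ (by finiteness), lintegral_add_left hθ]
      _ ≤ _ := by
          gcongr
          exact hlow _ ψ t (h' t ht)
  calc ∫⁻ t in Icc 0 δ, ∫⁻ x, ‖φ (stPt x t)‖ₑ ^ 6
      ≤ ∫⁻ t in Icc 0 δ, 2 ^ 5 * (K₁ * xEnergy b ψ ^ 3 + ∫⁻ x, H (stPt x t)) :=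
        setLIntegral_mono' measurableSet_Icc hslice
    _ = 2 ^ 5 * (K₁ * xEnergy b ψ ^ 3 * volume (Icc 0 δ) +
          ∫⁻ t in Icc 0 δ, ∫⁻ x, H (stPt x t)) := by
        rw [lintegral_const_mul' _ _ (by finiteness), lintegral_add_left measurable_const,
          setLIntegral_const]
    _ ≤ 2 ^ 5 * (K₁ * xEnergy b ψ ^ 3 * 1 + K₂ * xEnergy b ψ ^ 3) := by
        gcongr
        · rw [Real.volume_Icc, sub_zero]
          exact ENNReal.ofReal_le_one.2 hδ
        · exact (setLIntegral_lintegral_stPt_le hHm δ).trans (hhigh N hN ψ)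
    _ = _ := by ring

end PerFunctionBound

section RestrictedNorm
open scoped SchwartzMap

variable {s : ℝ} {m₁ : Rn 3 → ℝ}

/-- Transport of Schwartz functions from the product `ℝ³ × ℝ` to its `L²` version. -/
def toSpaceTime {E : Type*} [NormedAddCommGroup E] [NormedSpace ℂ E] (f : 𝓢(Rn 3 × ℝ, E)) :
    𝓢(SpaceTime, E) :=
  SchwartzMap.compCLMOfContinuousLinearEquiv ℂ (WithLp.prodContinuousLinearEquiv 2 ℝ (Rn 3) ℝ) f

theorem toSpaceTime_stPt {E : Type*} [NormedAddCommGroup E] [NormedSpace ℂ E]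
    (f : 𝓢(Rn 3 × ℝ, E)) (x : Rn 3) (t : ℝ) : toSpaceTime f (stPt x t) = f (x, t) := rfl

/-- Evaluation of a linear form on space-time at the spatial basis vectors. -/
def spatialPart : (Rn 3 × ℝ →L[ℝ] ℂ) →L[ℝ] EuclideanSpace ℂ (Fin 3) :=
  (PiLp.continuousLinearEquiv 2 ℝ fun _ : Fin 3 => ℂ).symm.toContinuousLinearMap ∘L
    ContinuousLinearMap.pi fun i =>
      ContinuousLinearMap.apply ℝ ℂ ((EuclideanSpace.single i 1, 0) : Rn 3 × ℝ)

theorem exists_schwartz_eq_gradC (θ : 𝓢(SpaceTime, ℂ)) :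
    ∃ ψ : 𝓢(Rn 3 × ℝ, EuclideanSpace ℂ (Fin 3)),
      ∀ x t, ψ (x, t) = gradC (fun y => θ (stPt y t)) x := by
  set θ' : 𝓢(Rn 3 × ℝ, ℂ) := SchwartzMap.compCLMOfContinuousLinearEquiv ℂ
    (WithLp.prodContinuousLinearEquiv 2 ℝ (Rn 3) ℝ).symm θ with hθ'
  refine ⟨(SchwartzMap.fderivCLM ℝ (Rn 3 × ℝ) ℂ θ').postcompCLM spatialPart, fun x t => ?_⟩
  have h1 : HasFDerivAt (fun y : Rn 3 => (y, t)) (ContinuousLinearMap.inl ℝ (Rn 3) ℝ) x :=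
    (hasFDerivAt_id x).prodMk (hasFDerivAt_const t x)
  have h2 : HasFDerivAt (fun y => θ (stPt y t))
      ((fderiv ℝ θ' (x, t)).comp (ContinuousLinearMap.inl ℝ (Rn 3) ℝ)) x :=
    HasFDerivAt.comp (g := θ') x (θ'.differentiableAt).hasFDerivAt h1
  ext i
  rw [gradC, h2.fderiv, SchwartzMap.postcompCLM_apply, SchwartzMap.fderivCLM_apply]
  simp [spatialPart]

theorem exists_lintegral_pow_six_le_XRNorm {b : ℝ} (hs : 5 / 6 < s) (hs1 : s < 1)
    (hb : 1 / 2 < b) (hb' : b ≤ 3 / 2) (hm : IsAdmissibleMultiplier 3 s m₁) :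
    ∃ K : ENNReal, K < ⊤ ∧ ∀ N, 1 ≤ N → ∀ δ : ℝ, δ ≤ 1 → ∀ φ : 𝓢(Rn 3 × ℝ, ℂ),
      ∫⁻ t in Icc 0 δ, ∫⁻ x, ‖φ (x, t)‖ₑ ^ 6 ≤
        K * ENNReal.ofReal
          (XRNorm 3 0 b δ fun x t => gradC (Iop m₁ N fun y => φ (y, t)) x) ^ 6 := by
  obtain ⟨K, hK, h⟩ := exists_lintegral_pow_six_le_xEnergy hs hs1 hb hm
  refine ⟨K, hK, fun N hN δ hδ φ => ?_⟩
  set S := {r : ℝ | ∃ ψ : 𝓢(Rn 3 × ℝ, EuclideanSpace ℂ (Fin 3)),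
    (∀ x : Rn 3, ∀ t ∈ Icc (0 : ℝ) δ, ψ (x, t) = gradC (Iop m₁ N fun y => φ (y, t)) x) ∧
    r = XNorm 3 0 b (fun x t => ψ (x, t))} with hS
  have hne : S.Nonempty := by
    obtain ⟨ψ, hψ⟩ := exists_schwartz_eq_gradC (iopSpaceTime m₁ N (toSpaceTime φ))
    refine ⟨_, ψ, fun x t _ => ?_, rfl⟩
    rw [hψ, funext fun y => iopSpaceTime_stPt hm N (toSpaceTime φ) y t]
    rfl
  have hbdd : BddBelow S := ⟨0, by rintro r ⟨ψ, -, rfl⟩; exact XNorm_nonneg b _⟩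
  have hclosed : IsClosed {r : ℝ | ∫⁻ t in Icc 0 δ, ∫⁻ x, ‖φ (x, t)‖ₑ ^ 6 ≤
      K * ENNReal.ofReal r ^ 6} :=
    isClosed_le continuous_const ((ENNReal.continuous_const_mul hK.ne).comp
      ((ENNReal.continuous_pow 6).comp ENNReal.continuous_ofReal))
  refine closure_minimal ?_ hclosed (csInf_mem_closure hne hbdd)
  rintro r ⟨ψ, hψ, rfl⟩
  have hE : xEnergy b (toSpaceTime ψ) =
      ENNReal.ofReal (XNorm 3 0 b (fun x t => ψ (x, t))) ^ 2 :=
    (ofReal_XNorm_sq hb' (toSpaceTime ψ)).symm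
  have key := h N hN δ hδ (toSpaceTime φ) (toSpaceTime ψ) fun t ht x => hψ x t ht
  rw [hE, ← pow_mul] at key
  exact key

theorem lintegral_enorm_Iop_sq_le (hm : IsAdmissibleMultiplier 3 s m₁) (N : ℝ)
    (f : 𝓢(Rn 3, ℂ)) : ∫⁻ x, ‖Iop m₁ N f x‖ₑ ^ 2 ≤ ∫⁻ x, ‖f x‖ₑ ^ 2 := by
  have hle : ∀ ξ, ‖(mN m₁ N ξ : ℂ) * 𝓕 ⇑f ξ‖ ≤ ‖𝓕 ⇑f ξ‖ := fun ξ => by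
    obtain ⟨h0, h1⟩ : 0 < mN m₁ N ξ ∧ mN m₁ N ξ ≤ 1 := hm.2.1 (N⁻¹ • ξ)
    rw [norm_mul, norm_real, Real.norm_of_nonneg h0.le]
    exact mul_le_of_le_one_left (norm_nonneg _) h1
  have hF := (𝓕 f).continuous
  rw [SchwartzMap.fourier_coe] at hF
  have hc := hm.continuous_mN N
  have hint : Integrable fun ξ => (mN m₁ N ξ : ℂ) * 𝓕 ⇑f ξ :=
    (𝓕 f).integrable.mono (Continuous.aestronglyMeasurable (by fun_prop)) (.of_forall hle)
  calc ∫⁻ x, ‖Iop m₁ N f x‖ₑ ^ 2 ≤ ∫⁻ ξ, ‖(mN m₁ N ξ : ℂ) * 𝓕 ⇑f ξ‖ₑ ^ 2 :=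
        lintegral_enorm_fourierInv_sq_le hint
    _ ≤ ∫⁻ ξ, ‖𝓕 ⇑f ξ‖ₑ ^ 2 := by
        gcongr with ξ
        rw [← ofReal_norm, ← ofReal_norm]
        exact ENNReal.ofReal_le_ofReal (hle ξ)
    _ ≤ _ := lintegral_enorm_fourier_sq_le f.integrable

theorem lintegral_enorm_Iop_mul_sq_le (hm : IsAdmissibleMultiplier 3 s m₁) (N : ℝ)
    (φ₁ φ₂ φ₃ : 𝓢(Rn 3 × ℝ, ℂ)) (t : ℝ) :
    ∫⁻ x, ‖Iop m₁ N (fun y => φ₁ (y, t) * φ₂ (y, t) * φ₃ (y, t)) x‖ₑ ^ 2 ≤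
      ∫⁻ x, ‖φ₁ (x, t) * φ₂ (x, t) * φ₃ (x, t)‖ₑ ^ 2 := by
  have h := lintegral_enorm_Iop_sq_le hm N (spaceSlice (SchwartzMap.smulLeftCLM ℂ
    ⇑(toSpaceTime φ₁) (SchwartzMap.smulLeftCLM ℂ ⇑(toSpaceTime φ₂) (toSpaceTime φ₃))) t)
  have h2 : ⇑(spaceSlice (SchwartzMap.smulLeftCLM ℂ ⇑(toSpaceTime φ₁)
      (SchwartzMap.smulLeftCLM ℂ ⇑(toSpaceTime φ₂) (toSpaceTime φ₃))) t) =
      fun y => φ₁ (y, t) * φ₂ (y, t) * φ₃ (y, t) := by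
    ext y
    rw [spaceSlice_apply, SchwartzMap.smulLeftCLM_apply_apply (toSpaceTime φ₁).hasTemperateGrowth,
      SchwartzMap.smulLeftCLM_apply_apply (toSpaceTime φ₂).hasTemperateGrowth]
    simp only [toSpaceTime_stPt, smul_eq_mul, mul_assoc]
  rwa [h2] at h

theorem lintegral_mul_sq_pow_le {α : Type*} [MeasurableSpace α] (μ : Measure α) {f g h : α → ℂ}
    (hf : Measurable f) (hg : Measurable g) (hh : Measurable h) :
    ∫⁻ a, ‖f a * g a * h a‖ₑ ^ 2 ∂μ ≤ ((∫⁻ a, ‖f a‖ₑ ^ 6 ∂μ) * (∫⁻ a, ‖g a‖ₑ ^ 6 ∂μ) *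
      ∫⁻ a, ‖h a‖ₑ ^ 6 ∂μ) ^ (1 / 3 : ℝ) := by
  have key := ENNReal.lintegral_prod_norm_pow_le (μ := μ) Finset.univ
    (f := ![fun a => ‖f a‖ₑ ^ 6, fun a => ‖g a‖ₑ ^ 6, fun a => ‖h a‖ₑ ^ 6])
    (p := fun _ => 1 / 3) (fun i _ => by
      fin_cases i
      · exact (hf.enorm.pow_const 6).aemeasurable
      · exact (hg.enorm.pow_const 6).aemeasurable
      · exact (hh.enorm.pow_const 6).aemeasurable)
    (by norm_num) (fun _ _ => by norm_num)
  have h6 : ∀ z : ENNReal, (z ^ 6) ^ (1 / 3 : ℝ) = z ^ 2 := fun z => by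
    rw [← ENNReal.rpow_natCast, ← ENNReal.rpow_mul, ← ENNReal.rpow_natCast]
    norm_num
  simp only [Fin.prod_univ_three, Matrix.cons_val_zero, Matrix.cons_val_one, Matrix.cons_val,
    h6] at key
  rw [ENNReal.mul_rpow_of_nonneg _ _ (by norm_num), ENNReal.mul_rpow_of_nonneg _ _ (by norm_num)]
  simpa only [enorm_mul, mul_pow] using key

theorem lintegral_mul_sq_le (φ₁ φ₂ φ₃ : 𝓢(Rn 3 × ℝ, ℂ)) (δ : ℝ) :
    ∫⁻ t in Icc 0 δ, ∫⁻ x, ‖φ₁ (x, t) * φ₂ (x, t) * φ₃ (x, t)‖ₑ ^ 2 ≤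
      ((∫⁻ t in Icc 0 δ, ∫⁻ x, ‖φ₁ (x, t)‖ₑ ^ 6) * (∫⁻ t in Icc 0 δ, ∫⁻ x, ‖φ₂ (x, t)‖ₑ ^ 6) *
        ∫⁻ t in Icc 0 δ, ∫⁻ x, ‖φ₃ (x, t)‖ₑ ^ 6) ^ (1 / 3 : ℝ) := by
  have hc : ∀ φ : 𝓢(Rn 3 × ℝ, ℂ), Measurable fun q : ℝ × Rn 3 => φ (q.2, q.1) := fun φ =>
    (φ.continuous.comp continuous_swap).measurable
  have hp : ∀ F : ℝ × Rn 3 → ENNReal, Measurable F → ∫⁻ t in Icc 0 δ, ∫⁻ x, F (t, x) =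
      ∫⁻ q, F q ∂((volume.restrict (Icc 0 δ)).prod volume) := fun F hF =>
    (lintegral_prod _ hF.aemeasurable).symm
  have h6 := fun φ : 𝓢(Rn 3 × ℝ, ℂ) => hp (fun q => ‖φ (q.2, q.1)‖ₑ ^ 6)
    ((hc φ).enorm.pow_const 6)
  have h2 := hp (fun q => ‖φ₁ (q.2, q.1) * φ₂ (q.2, q.1) * φ₃ (q.2, q.1)‖ₑ ^ 2)
    ((((hc φ₁).mul (hc φ₂)).mul (hc φ₃)).enorm.pow_const 2)
  simp only at h6 h2
  rw [h2, h6, h6, h6]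
  exact lintegral_mul_sq_pow_le _ (hc φ₁) (hc φ₂) (hc φ₃)

theorem XRNorm_nonneg {E : Type*} [NormedAddCommGroup E] [NormedSpace ℂ E] (b δ : ℝ)
    (f : Rn 3 → ℝ → E) : 0 ≤ XRNorm 3 0 b δ f :=
  Real.sInf_nonneg (by rintro r ⟨ψ, -, rfl⟩; exact XNorm_nonneg b _)

theorem ofReal_lpNormSTt_two_sq_le (δ : ℝ) (F : Rn 3 → ℝ → ℂ) :
    ENNReal.ofReal (lpNormSTt 3 2 δ F) ^ 2 ≤ ∫⁻ t in Icc 0 δ, ∫⁻ x, ‖F x t‖ₑ ^ 2 := by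
  have h0 : 0 ≤ ∫ t in Icc (0 : ℝ) δ, ∫ x : Rn 3, ‖F x t‖ ^ (2 : ℝ) :=
    integral_nonneg fun t => integral_nonneg fun x => by positivity
  rw [lpNormSTt, ← Real.sqrt_eq_rpow, ← ENNReal.ofReal_pow (Real.sqrt_nonneg _), Real.sq_sqrt h0]
  calc ENNReal.ofReal (∫ t in Icc (0 : ℝ) δ, ∫ x : Rn 3, ‖F x t‖ ^ (2 : ℝ))
      = ‖∫ t in Icc (0 : ℝ) δ, ∫ x : Rn 3, ‖F x t‖ ^ (2 : ℝ)‖ₑ := (Real.enorm_of_nonneg h0).symm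
    _ ≤ ∫⁻ t in Icc (0 : ℝ) δ, ‖∫ x : Rn 3, ‖F x t‖ ^ (2 : ℝ)‖ₑ :=
        enorm_integral_le_lintegral_enorm _
    _ ≤ ∫⁻ t in Icc (0 : ℝ) δ, ∫⁻ x, ‖‖F x t‖ ^ (2 : ℝ)‖ₑ :=
        lintegral_mono fun t => enorm_integral_le_lintegral_enorm _
    _ = _ := by simp

end RestrictedNorm

/-- L² bound for a cubic product in ℝ^{3+1}. -/
theorem statement_13 :
    ∀ s : ℝ, 5/6 < s → s < 1 →
    ∀ m₁ : Rn 3 → ℝ, IsAdmissibleMultiplier 3 s m₁ →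
    ∃ ε₀ > (0:ℝ), ∀ ε : ℝ, 0 < ε → ε < ε₀ →
    ∃ C > (0:ℝ),
    ∀ N : ℝ, 1 ≤ N → ∀ δ : ℝ, 0 < δ → δ ≤ 1 →
    ∀ φ₁ φ₂ φ₃ : SchwartzMap (Rn 3 × ℝ) ℂ,
    lpNormSTt 3 2 δ (fun x t =>
        Iop m₁ N (fun y => φ₁ (y, t) * φ₂ (y, t) * φ₃ (y, t)) x)
      ≤ C * XRNorm 3 0 (1/2 + ε) δ (fun x t => gradC (Iop m₁ N (fun y => φ₁ (y, t))) x) *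
          XRNorm 3 0 (1/2 + ε) δ (fun x t => gradC (Iop m₁ N (fun y => φ₂ (y, t))) x) *
          XRNorm 3 0 (1/2 + ε) δ (fun x t => gradC (Iop m₁ N (fun y => φ₃ (y, t))) x) := by
  intro s hs hs1 m₁ hm
  refine ⟨1, one_pos, fun ε hε hε1 => ?_⟩
  obtain ⟨K, hK, hbound⟩ := exists_lintegral_pow_six_le_XRNorm (b := 1 / 2 + ε) hs hs1
    (by linarith) (by linarith) hm
  refine ⟨√K.toReal + 1, by positivity, fun N hN δ _ hδ φ₁ φ₂ φ₃ => ?_⟩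
  have h₁ := hbound N hN δ hδ φ₁
  have h₂ := hbound N hN δ hδ φ₂
  have h₃ := hbound N hN δ hδ φ₃
  have hX₁ := XRNorm_nonneg (1 / 2 + ε) δ fun x t => gradC (Iop m₁ N fun y => φ₁ (y, t)) x
  have hX₂ := XRNorm_nonneg (1 / 2 + ε) δ fun x t => gradC (Iop m₁ N fun y => φ₂ (y, t)) x
  have hX₃ := XRNorm_nonneg (1 / 2 + ε) δ fun x t => gradC (Iop m₁ N fun y => φ₃ (y, t)) x
  set X₁ := XRNorm 3 0 (1 / 2 + ε) δ fun x t => gradC (Iop m₁ N fun y => φ₁ (y, t)) x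
  set X₂ := XRNorm 3 0 (1 / 2 + ε) δ fun x t => gradC (Iop m₁ N fun y => φ₂ (y, t)) x
  set X₃ := XRNorm 3 0 (1 / 2 + ε) δ fun x t => gradC (Iop m₁ N fun y => φ₃ (y, t)) x
  set F : Rn 3 → ℝ → ℂ := fun x t =>
    Iop m₁ N (fun y => φ₁ (y, t) * φ₂ (y, t) * φ₃ (y, t)) x with hF
  have key : ENNReal.ofReal (lpNormSTt 3 2 δ F) ^ 2 ≤
      ENNReal.ofReal (√K.toReal * (X₁ * X₂ * X₃)) ^ 2 := by
    calc ENNReal.ofReal (lpNormSTt 3 2 δ F) ^ 2 ≤ ∫⁻ t in Icc 0 δ, ∫⁻ x, ‖F x t‖ₑ ^ 2 :=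
          ofReal_lpNormSTt_two_sq_le δ F
      _ ≤ ∫⁻ t in Icc 0 δ, ∫⁻ x, ‖φ₁ (x, t) * φ₂ (x, t) * φ₃ (x, t)‖ₑ ^ 2 :=
          lintegral_mono fun t => lintegral_enorm_Iop_mul_sq_le hm N φ₁ φ₂ φ₃ t
      _ ≤ _ := lintegral_mul_sq_le φ₁ φ₂ φ₃ δ
      _ ≤ ((K * ENNReal.ofReal X₁ ^ 6) * (K * ENNReal.ofReal X₂ ^ 6) *
            (K * ENNReal.ofReal X₃ ^ 6)) ^ (1 / 3 : ℝ) := by gcongr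
      _ = ((K * ENNReal.ofReal (X₁ * X₂ * X₃) ^ 2) ^ 3) ^ (1 / 3 : ℝ) := by
          rw [ENNReal.ofReal_mul (mul_nonneg hX₁ hX₂), ENNReal.ofReal_mul hX₁]
          congr 1
          ring
      _ = K * ENNReal.ofReal (X₁ * X₂ * X₃) ^ 2 := by
          rw [← ENNReal.rpow_natCast, ← ENNReal.rpow_mul]
          norm_num
      _ = _ := by
          rw [ENNReal.ofReal_mul (Real.sqrt_nonneg _), mul_pow,
            ← ENNReal.ofReal_pow (Real.sqrt_nonneg _), Real.sq_sqrt ENNReal.toReal_nonneg,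
            ENNReal.ofReal_toReal hK.ne]
  have hX : 0 ≤ X₁ * X₂ * X₃ := by positivity
  have hle := (ENNReal.ofReal_le_ofReal_iff (by positivity)).1
    ((ENNReal.pow_le_pow_left_iff two_ne_zero).1 key)
  calc lpNormSTt 3 2 δ F ≤ √K.toReal * (X₁ * X₂ * X₃) := hle
    _ ≤ (√K.toReal + 1) * X₁ * X₂ * X₃ := by linarith

end
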